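/- arXiv:1507.03549 — 12 statements merged into one kernel-verified Lean document; each statement's English description precedes it below -/
import Mathlib

section
/- Let α be a rational number and let ε be a rational number with 0 < ε ≤ 1. Then there exist integers p and q such that |α - p/q| < ε/q, 1 ≤ q ≤ 1/ε, and |p| ≤ ⌈|α|⌉·q. -/
/-- Scalar Diophantine approximation (existence content of Schrijver, Corollary 6.2a):
for rational `α` and rational `0 < ε ≤ 1` there are integers `p, q` with
`|α - p/q| < ε/q`, `1 ≤ q ≤ 1/ε` and `|p| ≤ ⌈|α|⌉ q`. -/
theorem diophantine_approximation_scalar (α ε : ℚ) (hε0 : 0 < ε) (hε1 : ε ≤ 1) :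
    ∃ p q : ℤ, |α - (p : ℚ) / (q : ℚ)| < ε / (q : ℚ) ∧
      1 ≤ q ∧ (q : ℚ) ≤ 1 / ε ∧ |p| ≤ ⌈|α|⌉ * q := by
  have hn : 0 < ⌊1 / ε⌋₊ := Nat.floor_pos.2 ((one_le_div hε0).2 hε1)
  obtain ⟨p, q, hq0, hqn, hreal⟩ := Real.exists_int_int_abs_mul_sub_le (α : ℝ) hn
  have hrat : |(q : ℚ) * α - p| ≤ 1 / ((⌊1 / ε⌋₊ : ℚ) + 1) := by
    rw [← Rat.cast_le (K := ℝ)]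
    push_cast
    exact hreal
  have herr : |(q : ℚ) * α - p| < ε :=
    hrat.trans_lt ((one_div_lt (by positivity) hε0).2 (Nat.lt_floor_add_one _))
  have hq : (0 : ℚ) < q := by exact_mod_cast hq0
  refine ⟨p, q, ?_, hq0, ?_, ?_⟩
  · rwa [lt_div_iff₀ hq, ← abs_of_pos hq, ← abs_mul, abs_of_pos hq, sub_mul,
      div_mul_cancel₀ _ hq.ne', mul_comm α]
  · have hqn' : (q : ℚ) ≤ (⌊1 / ε⌋₊ : ℚ) := by exact_mod_cast hqn
    exact hqn'.trans (Nat.floor_le (by positivity))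
  · have htri : |(p : ℚ)| ≤ |(q : ℚ) * α| + |(q : ℚ) * α - p| := by
      simpa using abs_sub ((q : ℚ) * α) ((q : ℚ) * α - p)
    rw [abs_mul, abs_of_pos hq] at htri
    have hceil := mul_le_mul_of_nonneg_left (Int.le_ceil |α|) hq.le
    have hlt : |(p : ℚ)| < ⌈|α|⌉ * q + 1 := by linarith
    exact Int.lt_add_one_iff.1 (by exact_mod_cast hlt)
end

section
/- Let α = (α₁,…,αₙ) ∈ ℚⁿ be a rational vector and ε > 0 rational with ε ≤ 1. Then there exist integers p₁,…,pₙ and q₁,…,qₙ with qᵢ ≥ 1 such that ‖(α₁,…,αₙ) - (p₁/q₁,…,pₙ/qₙ)‖₂ < ε and n + ∑_{i=1}^n size(pᵢ/qᵢ) ≤ n·(6 + log₂(n²·⌈‖α‖_∞⌉/ε²)), where ‖α‖_∞ = maxᵢ |αᵢ| and ‖·‖₂ is the Euclidean norm. -/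
/-- The bit size of the fraction `p/q` (for an integer `p` and a positive integer `q`):
`size(p/q) = 1 + ⌈log₂(max(|p|,1)) + 1⌉ + ⌈log₂ q + 1⌉`. -/
noncomputable def fracSize (p q : ℤ) : ℤ :=
  1 + ⌈Real.logb 2 ((max |p| 1 : ℤ) : ℝ) + 1⌉ + ⌈Real.logb 2 (q : ℝ) + 1⌉

theorem fracSize_le {p q : ℤ} (hq : 1 ≤ q) :
    (fracSize p q : ℝ) ≤ 5 + Real.logb 2 (((max |p| 1 : ℤ) : ℝ) * (q : ℝ)) := by
  have hp : (0 : ℝ) < ((max |p| 1 : ℤ) : ℝ) := by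
    exact_mod_cast lt_of_lt_of_le one_pos (le_max_right _ _)
  have hq' : (0 : ℝ) < (q : ℝ) := by exact_mod_cast one_pos.trans_le hq
  rw [Real.logb_mul hp.ne' hq'.ne', fracSize]
  have h₁ := Int.ceil_lt_add_one (Real.logb 2 ((max |p| 1 : ℤ) : ℝ) + 1)
  have h₂ := Int.ceil_lt_add_one (Real.logb 2 (q : ℝ) + 1)
  simp only [Int.cast_add, Int.cast_one]
  linarith

/-- Rounding `x * q` to the nearest integer does not leave the integral interval `[-M * q, M * q]`
when `|x| ≤ M`. -/
theorem abs_round_mul_le {x : ℝ} {M q : ℤ} (hq : 0 ≤ q) (hx : |x| ≤ M) :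
    |round (x * q)| ≤ M * q := by
  have hq' : (0 : ℝ) ≤ q := by exact_mod_cast hq
  obtain ⟨h₁, h₂⟩ := abs_le.mp hx
  have hu : x * q ≤ M * q := mul_le_mul_of_nonneg_right h₂ hq'
  have hl : -(M : ℝ) * q ≤ x * q := mul_le_mul_of_nonneg_right h₁ hq'
  rw [abs_le, round_eq]
  constructor
  · rw [Int.le_floor]
    push_cast
    linarith
  · rw [← Int.lt_add_one_iff, Int.floor_lt]
    push_cast
    linarith

theorem abs_sub_round_mul_div_le (x : ℝ) {q : ℤ} (hq : 0 < q) :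
    |x - (round (x * q) : ℝ) / q| ≤ 1 / (2 * q) := by
  have hq' : (0 : ℝ) < q := by exact_mod_cast hq
  have h : x - (round (x * q) : ℝ) / q = (x * q - round (x * q)) / q := by
    field_simp
  rw [h, abs_div, abs_of_pos hq', div_le_iff₀ hq']
  refine (abs_sub_round _).trans_eq ?_
  field_simp

theorem sqrt_sum_sq_lt {n : ℕ} (hn : 0 < n) {ε : ℝ} (hε : 0 < ε) {x : Fin n → ℝ}
    (hx : ∀ i, |x i| < ε / n) : Real.sqrt (∑ i, x i ^ 2) < ε := by
  have hn₁ : (1 : ℝ) ≤ n := by exact_mod_cast hn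
  rw [Real.sqrt_lt' hε]
  have : Nonempty (Fin n) := ⟨⟨0, hn⟩⟩
  calc ∑ i, x i ^ 2 < ∑ _i : Fin n, (ε / n) ^ 2 :=
        Finset.sum_lt_sum_of_nonempty Finset.univ_nonempty
          fun i _ => sq_lt_sq' (abs_lt.mp (hx i)).1 (abs_lt.mp (hx i)).2
    _ = ε ^ 2 / n := by
        simp only [Finset.sum_const, Finset.card_univ, Fintype.card_fin, nsmul_eq_mul]
        field_simp
    _ ≤ ε ^ 2 := div_le_self (sq_nonneg ε) hn₁

/-- Vector Diophantine approximation with a bit-size bound (Corollary 2 of the paper):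
for a rational vector `α` and rational `0 < ε ≤ 1` there are integers `pᵢ, qᵢ ≥ 1` with
`‖α - (p₁/q₁,…,pₙ/qₙ)‖₂ < ε` and total bit size at most `n (6 + log₂(n² ⌈‖α‖_∞⌉ / ε²))`. -/
theorem diophantine_approximation_bitsize (n : ℕ) (α : Fin n → ℚ) (ε : ℚ)
    (hε0 : 0 < ε) (hε1 : ε ≤ 1) :
    ∃ p q : Fin n → ℤ, (∀ i, 1 ≤ q i) ∧
      Real.sqrt (∑ i, ((α i : ℝ) - (p i : ℝ) / (q i : ℝ)) ^ 2) < (ε : ℝ) ∧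
      (n : ℝ) + ∑ i, (fracSize (p i) (q i) : ℝ) ≤
        (n : ℝ) * (6 + Real.logb 2
          ((n : ℝ) ^ 2 * ((Finset.univ.sup fun i => ⌈|α i|⌉.toNat : ℕ) : ℝ) /
            (ε : ℝ) ^ 2)) := by
  have hε : (0 : ℝ) < ε := by exact_mod_cast hε0
  have hε' : (ε : ℝ) ≤ 1 := by exact_mod_cast hε1
  set A : ℕ := Finset.univ.sup fun i => ⌈|α i|⌉.toNat with hA
  have hαA (i : Fin n) : |(α i : ℝ)| ≤ A := by
    have h₁ : ⌈|α i|⌉.toNat ≤ A :=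
      Finset.le_sup (f := fun i => ⌈|α i|⌉.toNat) (Finset.mem_univ i)
    have h₂ : |α i| ≤ (A : ℤ) :=
      (Int.le_ceil _).trans (by exact_mod_cast (Int.self_le_toNat _).trans (Int.ofNat_le.mpr h₁))
    exact_mod_cast h₂
  rcases Nat.eq_zero_or_pos A with hA0 | hApos
  · have hα (i : Fin n) : (α i : ℝ) = 0 := by
      simpa [hA0] using hαA i
    refine ⟨fun _ => 0, fun _ => 1, fun _ => le_rfl, by simpa [hα] using hε, ?_⟩
    simp only [hA0, fracSize]
    norm_num
    linarith [n.cast_nonneg (α := ℝ)]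
  rcases Nat.eq_zero_or_pos n with rfl | hn
  · exact ⟨fun _ => 0, fun _ => 1, fun _ => le_rfl, by simpa using hε, by simp⟩
  have hn₁ : (1 : ℝ) ≤ n := by exact_mod_cast hn
  have hA₁ : (1 : ℝ) ≤ A := by exact_mod_cast hApos
  set q : ℤ := ⌊(n : ℝ) / ε⌋ with hq
  have hq₁ : 1 ≤ q := Int.le_floor.mpr (by
    rw [Int.cast_one, le_div_iff₀ hε]
    linarith)
  have hq₁' : (1 : ℝ) ≤ q := by exact_mod_cast hq₁
  have hq_le : (q : ℝ) ≤ n / ε := Int.floor_le _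
  have hq_gt : (n : ℝ) / ε < 2 * q := by
    linarith [Int.lt_floor_add_one ((n : ℝ) / ε)]
  refine ⟨fun i => round ((α i : ℝ) * q), fun _ => q, fun _ => hq₁,
    sqrt_sum_sq_lt hn hε fun i => (abs_sub_round_mul_div_le _ (by omega)).trans_lt ?_, ?_⟩
  · rw [← one_div_div (n : ℝ)]
    exact one_div_lt_one_div_of_lt (by positivity) hq_gt
  have hsize (i : Fin n) : (fracSize (round ((α i : ℝ) * q)) q : ℝ) ≤
      5 + Real.logb 2 ((n : ℝ) ^ 2 * (A : ℝ) / (ε : ℝ) ^ 2) := by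
    refine (fracSize_le hq₁).trans ?_
    have hp : max |round ((α i : ℝ) * q)| 1 ≤ (A : ℤ) * q :=
      max_le (abs_round_mul_le (by omega) (by exact_mod_cast hαA i))
        (one_le_mul_of_one_le_of_one_le (by exact_mod_cast hApos) hq₁)
    have hp' : ((max |round ((α i : ℝ) * q)| 1 : ℤ) : ℝ) ≤ A * q := by exact_mod_cast hp
    have hp₀ : (0 : ℝ) < ((max |round ((α i : ℝ) * q)| 1 : ℤ) : ℝ) := by
      exact_mod_cast one_pos.trans_le (le_max_right _ _)
    gcongr
    · norm_num
    calc ((max |round ((α i : ℝ) * q)| 1 : ℤ) : ℝ) * q ≤ A * q * q := by gcongr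
      _ = A * (q : ℝ) ^ 2 := by ring
      _ ≤ A * ((n : ℝ) / ε) ^ 2 := by gcongr
      _ = (n : ℝ) ^ 2 * A / (ε : ℝ) ^ 2 := by ring
  calc (n : ℝ) + ∑ i, (fracSize (round ((α i : ℝ) * q)) q : ℝ)
      ≤ n + ∑ _i : Fin n, (5 + Real.logb 2 ((n : ℝ) ^ 2 * (A : ℝ) / (ε : ℝ) ^ 2)) := by
        gcongr with i
        exact hsize i
    _ = _ := by
        simp only [Finset.sum_const, Finset.card_univ, Fintype.card_fin, nsmul_eq_mul]
        ring
end

section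
/- Let X be an n×n real symmetric positive definite matrix and let Y be an n×n real symmetric matrix with ‖Y - X‖_X < 1. Then Y is positive definite. -/
/-- The local (intrinsic) norm `‖V‖_W = (tr(W⁻¹ V W⁻¹ V))^{1/2}` of a symmetric matrix `V`
at a positive definite matrix `W`, coming from the Hessian of the barrier `-ln det`. -/
noncomputable def localNorm {n : ℕ} (W V : Matrix (Fin n) (Fin n) ℝ) : ℝ :=
  Real.sqrt ((W⁻¹ * V * W⁻¹ * V).trace)

namespace Matrix

variable {m : Type*} [Fintype m]

/-- The quadratic form of a real symmetric matrix is bounded by its Frobenius norm. -/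
theorem IsSymm.sq_dotProduct_mulVec_le {M : Matrix m m ℝ} (hM : M.IsSymm) (x : m → ℝ) :
    (x ⬝ᵥ (M *ᵥ x)) ^ 2 ≤ (M * M).trace * (x ⬝ᵥ x) ^ 2 := by
  have hform : x ⬝ᵥ (M *ᵥ x) = ∑ p : m × m, M p.1 p.2 * (x p.1 * x p.2) := by
    simp only [dotProduct, mulVec, Finset.mul_sum, Fintype.sum_prod_type]
    exact Finset.sum_congr rfl fun i _ => Finset.sum_congr rfl fun j _ => by ring
  have htrace : (M * M).trace = ∑ p : m × m, M p.1 p.2 ^ 2 := by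
    simp only [trace, diag_apply, mul_apply, Fintype.sum_prod_type]
    exact Finset.sum_congr rfl fun i _ => Finset.sum_congr rfl fun j _ => by
      rw [hM.apply i j, sq]
  have hnorm : (x ⬝ᵥ x) ^ 2 = ∑ p : m × m, (x p.1 * x p.2) ^ 2 := by
    simp only [dotProduct, sq, Finset.sum_mul_sum, Fintype.sum_prod_type]
    exact Finset.sum_congr rfl fun i _ => Finset.sum_congr rfl fun j _ => by ring
  rw [hform, htrace, hnorm]
  exact Finset.sum_mul_sq_le_sq_mul_sq _ _ _

variable [DecidableEq m]

/-- A symmetric perturbation of the identity of Frobenius norm less than one is positive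
definite. -/
theorem IsSymm.posDef_one_add {M : Matrix m m ℝ} (hM : M.IsSymm) (h : (M * M).trace < 1) :
    (1 + M).PosDef := by
  refine .of_dotProduct_mulVec_pos (isHermitian_one.add ?_) fun x hx => ?_
  · rwa [IsHermitian, conjTranspose_eq_transpose_of_trivial]
  · have hpos : 0 < x ⬝ᵥ x := by simpa using dotProduct_star_self_pos_iff.mpr hx
    have habs : |x ⬝ᵥ (M *ᵥ x)| < x ⬝ᵥ x := by
      refine abs_lt_of_sq_lt_sq ((hM.sq_dotProduct_mulVec_le x).trans_lt ?_) hpos.le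
      exact mul_lt_of_lt_one_left (by positivity) h
    rw [star_trivial, add_mulVec, one_mulVec, dotProduct_add]
    linarith [(abs_lt.mp habs).1]

open scoped MatrixOrder in
/-- A real positive definite matrix is `Bᵀ * B` for an invertible `B`. -/
theorem PosDef.exists_isUnit_eq_transpose_mul_self {X : Matrix m m ℝ} (hX : X.PosDef) :
    ∃ B : Matrix m m ℝ, IsUnit B ∧ X = Bᵀ * B := by
  obtain ⟨B, hB, rfl⟩ := CStarAlgebra.isStrictlyPositive_iff_eq_star_mul_self.mp
    hX.isStrictlyPositive
  exact ⟨B, hB, by rw [star_eq_conjTranspose, conjTranspose_eq_transpose_of_trivial]⟩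

end Matrix

open Matrix in
/-- First self-concordance property of the barrier `X ↦ -ln det X`: if `X` is symmetric
positive definite and `Y` is symmetric with `‖Y - X‖_X < 1`, then `Y` is positive definite. -/
theorem posDef_of_localNorm_lt_one {n : ℕ} (X Y : Matrix (Fin n) (Fin n) ℝ)
    (hX : X.PosDef) (hY : Y.IsSymm) (h : localNorm X (Y - X) < 1) :
    Y.PosDef := by
  obtain ⟨B, hB, rfl⟩ := hX.exists_isUnit_eq_transpose_mul_self
  have hdet : IsUnit B.det := (isUnit_iff_isUnit_det B).mp hB
  set V := Y - Bᵀ * B with hV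
  have hVsymm : V.IsSymm := hY.sub (isSymm_transpose_mul_self B)
  have hMsymm : (B⁻¹ᵀ * V * B⁻¹).IsSymm := by
    simp [IsSymm, transpose_mul, hVsymm.eq, Matrix.mul_assoc]
  have htrace : (B⁻¹ᵀ * V * B⁻¹ * (B⁻¹ᵀ * V * B⁻¹)).trace < 1 := by
    rw [localNorm, Real.sqrt_lt' one_pos, one_pow, Matrix.mul_inv_rev, ← transpose_nonsing_inv] at h
    convert h using 1
    rw [← Matrix.mul_assoc, trace_mul_comm]
    simp only [Matrix.mul_assoc]
  have hYeq : Y = star B * (1 + B⁻¹ᵀ * V * B⁻¹) * B := by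
    have hB' : Bᵀ * B⁻¹ᵀ = 1 := by rw [← transpose_mul, nonsing_inv_mul B hdet, transpose_one]
    calc Y = Bᵀ * B + (Bᵀ * B⁻¹ᵀ) * V * (B⁻¹ * B) := by
          rw [hB', nonsing_inv_mul B hdet, hV]; simp
      _ = _ := by
          rw [star_eq_conjTranspose, conjTranspose_eq_transpose_of_trivial]; noncomm_ring
  rw [hYeq, hB.posDef_star_left_conjugate_iff]
  exact hMsymm.posDef_one_add htrace
end

section
/- Let X be an n×n real symmetric positive definite matrix and let Y be an n×n real symmetric matrix with ‖Y - X‖_X < 1. Then for every nonzero n×n real symmetric matrix V one has 1 - ‖Y - X‖_X ≤ ‖V‖_Y / ‖V‖_X ≤ 1/(1 - ‖Y - X‖_X). -/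
open Matrix in
/-- The local norm is invariant under congruence by an invertible matrix. -/
theorem localNorm_congr {n : ℕ} {P : Matrix (Fin n) (Fin n) ℝ} (hP : IsUnit P)
    (W V : Matrix (Fin n) (Fin n) ℝ) :
    localNorm (P * W * Pᵀ) (P * V * Pᵀ) = localNorm W V := by
  have hP' : IsUnit P.det := (isUnit_iff_isUnit_det P).mp hP
  have hPt : IsUnit Pᵀ.det := by rwa [det_transpose]
  have key : (P * W * Pᵀ)⁻¹ * (P * V * Pᵀ) = Pᵀ⁻¹ * (W⁻¹ * V * Pᵀ) := by
    rw [Matrix.mul_inv_rev, Matrix.mul_inv_rev]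
    simp only [Matrix.mul_assoc]
    rw [nonsing_inv_mul_cancel_left _ _ hP']
  unfold localNorm
  rw [Matrix.mul_assoc _ (P * W * Pᵀ)⁻¹, key, Matrix.mul_assoc, ← Matrix.mul_assoc (W⁻¹ * V * Pᵀ),
    mul_nonsing_inv_cancel_right _ _ hPt, trace_mul_comm, Matrix.mul_assoc, Matrix.mul_assoc,
    mul_nonsing_inv_cancel_right _ _ hPt]
  simp only [Matrix.mul_assoc]

/-- The local norm of a symmetric matrix at a positive diagonal matrix, in coordinates. -/
theorem localNorm_diagonal {n : ℕ} {d : Fin n → ℝ} (hd : ∀ i, 0 < d i)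
    {W : Matrix (Fin n) (Fin n) ℝ} (hW : W.IsSymm) :
    localNorm (Matrix.diagonal d) W = Real.sqrt (∑ i, ∑ j, W i j ^ 2 / (d i * d j)) := by
  have hinv : (Matrix.diagonal d)⁻¹ = Matrix.diagonal fun i => (d i)⁻¹ := by
    refine Matrix.inv_eq_right_inv ?_
    rw [Matrix.diagonal_mul_diagonal, ← Matrix.diagonal_one]
    congr 1
    ext i
    exact mul_inv_cancel₀ (hd i).ne'
  unfold localNorm
  rw [hinv, Matrix.mul_assoc _ (Matrix.diagonal _) W]
  simp only [Matrix.trace, Matrix.diag_apply, Matrix.mul_apply (M := _ * W), Matrix.diagonal_mul]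
  congr 1
  refine Finset.sum_congr rfl fun i _ => Finset.sum_congr rfl fun j _ => ?_
  rw [hW.apply i j]
  have := (hd i).ne'
  have := (hd j).ne'
  field_simp

open Matrix MatrixOrder in
/-- A positive definite matrix and a symmetric matrix are simultaneously diagonalized by a
congruence that takes the former to the identity. -/
theorem exists_isUnit_congr_diagonal {n : ℕ} {X Y : Matrix (Fin n) (Fin n) ℝ}
    (hX : X.PosDef) (hY : Y.IsSymm) :
    ∃ (P : Matrix (Fin n) (Fin n) ℝ) (d : Fin n → ℝ),
      IsUnit P ∧ X = P * 1 * Pᵀ ∧ Y = P * diagonal d * Pᵀ := by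
  obtain ⟨B, hB, rfl⟩ : ∃ B : Matrix (Fin n) (Fin n) ℝ, IsUnit B ∧ X = B * Bᵀ := by
    obtain ⟨B, hB, rfl⟩ := CStarAlgebra.isStrictlyPositive_iff_eq_mul_star_self.mp
      hX.isStrictlyPositive
    exact ⟨B, hB, by rw [star_eq_conjTranspose, conjTranspose_eq_transpose_of_trivial]⟩
  have hB' : IsUnit B.det := (isUnit_iff_isUnit_det B).mp hB
  have hBt : IsUnit Bᵀ.det := by rwa [det_transpose]
  have hH : (B⁻¹ * Y * Bᵀ⁻¹).IsHermitian := by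
    rw [IsHermitian, conjTranspose_eq_transpose_of_trivial]
    simp only [transpose_mul, transpose_nonsing_inv, transpose_transpose, hY.eq, Matrix.mul_assoc]
  set U : Matrix (Fin n) (Fin n) ℝ := ↑hH.eigenvectorUnitary
  have hUU : U * Uᵀ = 1 := by
    simpa [star_eq_conjTranspose] using Unitary.coe_mul_star_self hH.eigenvectorUnitary
  have hspec : B⁻¹ * Y * Bᵀ⁻¹ = U * diagonal hH.eigenvalues * Uᵀ := by
    have := hH.spectral_theorem
    rw [Unitary.conjStarAlgAut_apply] at this
    simpa [star_eq_conjTranspose] using this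
  refine ⟨B * U, hH.eigenvalues, ?_, ?_, ?_⟩
  · exact hB.mul (IsUnit.of_mul_eq_one _ hUU)
  · rw [transpose_mul, Matrix.mul_one, Matrix.mul_assoc, ← Matrix.mul_assoc U, hUU, Matrix.one_mul]
  · calc Y = B * (B⁻¹ * Y * Bᵀ⁻¹) * Bᵀ := by
          rw [Matrix.mul_assoc, nonsing_inv_mul_cancel_right _ _ hBt,
            mul_nonsing_inv_cancel_left _ _ hB']
      _ = B * (U * diagonal hH.eigenvalues * Uᵀ) * Bᵀ := congrArg (B * · * Bᵀ) hspec
      _ = _ := by simp only [transpose_mul, Matrix.mul_assoc]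

/-- The second self-concordance property at the identity, for a diagonal `Y`. -/
theorem localNorm_ratio_diagonal {n : ℕ} (d : Fin n → ℝ)
    (h : localNorm 1 (Matrix.diagonal d - 1) < 1)
    {W : Matrix (Fin n) (Fin n) ℝ} (hW : W.IsSymm) (hW0 : W ≠ 0) :
    1 - localNorm 1 (Matrix.diagonal d - 1) ≤ localNorm (Matrix.diagonal d) W / localNorm 1 W ∧
      localNorm (Matrix.diagonal d) W / localNorm 1 W ≤
        1 / (1 - localNorm 1 (Matrix.diagonal d - 1)) := by
  have hr : localNorm 1 (Matrix.diagonal d - 1) = Real.sqrt (∑ i, (d i - 1) ^ 2) := by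
    have : Matrix.diagonal d - 1 = Matrix.diagonal fun i => d i - 1 := by
      rw [← Matrix.diagonal_one, Matrix.diagonal_sub]
    simp [localNorm, this, Matrix.trace_diagonal, sq]
  set r := localNorm 1 (Matrix.diagonal d - 1)
  have hr0 : 0 ≤ r := Real.sqrt_nonneg _
  have habs (i) : |d i - 1| ≤ r := by
    rw [hr]
    refine Real.abs_le_sqrt ?_
    exact Finset.single_le_sum (f := fun i => (d i - 1) ^ 2) (fun _ _ => sq_nonneg _)
      (Finset.mem_univ i)
  have hlo (i) : 1 - r ≤ d i := by linarith [(abs_le.mp (habs i)).1]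
  have hhi (i) : d i ≤ 1 + r := by linarith [(abs_le.mp (habs i)).2]
  have hd (i) : 0 < d i := by linarith [hlo i]
  have h1r : 0 < 1 - r := by linarith
  have hone : localNorm 1 W = Real.sqrt (∑ i, ∑ j, W i j ^ 2) := by
    rw [← Matrix.diagonal_one, localNorm_diagonal (fun _ => one_pos) hW]
    simp
  have hpos : 0 < localNorm 1 W := by
    rw [hone, Real.sqrt_pos]
    obtain ⟨i, j, hij⟩ : ∃ i j, W i j ≠ 0 := by
      by_contra! hne
      exact hW0 (Matrix.ext hne)
    refine Finset.sum_pos' (fun _ _ => Finset.sum_nonneg fun _ _ => sq_nonneg _)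
      ⟨i, Finset.mem_univ i, ?_⟩
    exact Finset.sum_pos' (fun _ _ => sq_nonneg _) ⟨j, Finset.mem_univ j, by positivity⟩
  rw [le_div_iff₀ hpos, div_le_iff₀ hpos, hone, localNorm_diagonal hd hW]
  constructor
  · rw [← Real.sqrt_sq h1r.le, ← Real.sqrt_mul (sq_nonneg _)]
    refine Real.sqrt_le_sqrt ?_
    simp only [Finset.mul_sum]
    refine Finset.sum_le_sum fun i _ => Finset.sum_le_sum fun j _ => ?_
    rw [le_div_iff₀ (mul_pos (hd i) (hd j))]
    have hdd : d i * d j ≤ (1 + r) * (1 + r) :=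
      mul_le_mul (hhi i) (hhi j) (hd j).le (by linarith)
    have hle : (1 - r) ^ 2 * (d i * d j) ≤ 1 := by
      calc (1 - r) ^ 2 * (d i * d j) ≤ (1 - r) ^ 2 * ((1 + r) * (1 + r)) := by gcongr
        _ = (1 - r ^ 2) ^ 2 := by ring
        _ ≤ 1 := pow_le_one₀ (by nlinarith) (by nlinarith)
    nlinarith [mul_le_mul_of_nonneg_left hle (sq_nonneg (W i j))]
  · rw [← Real.sqrt_sq (one_div_pos.mpr h1r).le, ← Real.sqrt_mul (sq_nonneg _)]
    refine Real.sqrt_le_sqrt ?_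
    simp only [Finset.mul_sum]
    refine Finset.sum_le_sum fun i _ => Finset.sum_le_sum fun j _ => ?_
    have hdd : (1 - r) ^ 2 ≤ d i * d j := by
      rw [sq]
      exact mul_le_mul (hlo i) (hlo j) h1r.le (hd i).le
    calc W i j ^ 2 / (d i * d j) ≤ W i j ^ 2 / (1 - r) ^ 2 := by gcongr
      _ = (1 / (1 - r)) ^ 2 * W i j ^ 2 := by rw [one_div, inv_pow, div_eq_inv_mul]

/-- Second self-concordance property of the barrier `X ↦ -ln det X`: if `X` is symmetric
positive definite and `Y` is symmetric with `‖Y - X‖_X < 1`, then for every nonzero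
symmetric `V` one has `1 - ‖Y - X‖_X ≤ ‖V‖_Y / ‖V‖_X ≤ 1/(1 - ‖Y - X‖_X)`. -/
theorem self_concordance_norm_ratio {n : ℕ} (X Y : Matrix (Fin n) (Fin n) ℝ)
    (hX : X.PosDef) (hY : Y.IsSymm) (h : localNorm X (Y - X) < 1)
    (V : Matrix (Fin n) (Fin n) ℝ) (hV : V.IsSymm) (hV0 : V ≠ 0) :
    1 - localNorm X (Y - X) ≤ localNorm Y V / localNorm X V ∧
      localNorm Y V / localNorm X V ≤ 1 / (1 - localNorm X (Y - X)) := by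
  obtain ⟨P, d, hP, rfl, rfl⟩ := exists_isUnit_congr_diagonal hX hY
  have hP' : IsUnit P.det := (Matrix.isUnit_iff_isUnit_det P).mp hP
  have hPt : IsUnit P.transpose.det := by rwa [Matrix.det_transpose]
  obtain ⟨W, hWdef⟩ : ∃ W, W = P⁻¹ * V * P.transpose⁻¹ := ⟨_, rfl⟩
  have hW : W.IsSymm := by
    rw [Matrix.IsSymm, hWdef]
    simp only [Matrix.transpose_mul, Matrix.transpose_nonsing_inv, Matrix.transpose_transpose,
      hV.eq, Matrix.mul_assoc]
  obtain rfl : V = P * W * P.transpose := by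
    rw [hWdef, Matrix.mul_assoc, Matrix.nonsing_inv_mul_cancel_right _ _ hPt,
      Matrix.mul_nonsing_inv_cancel_left _ _ hP']
  have hW0 : W ≠ 0 := by
    rintro rfl
    simp at hV0
  rw [← Matrix.sub_mul, ← Matrix.mul_sub] at h ⊢
  simp only [localNorm_congr hP] at h ⊢
  exact localNorm_ratio_diagonal d h hW hW0
end

section
/- Let L be a linear subspace of 𝒮ⁿ with orthogonal projection π_L, let X be an n×n real symmetric positive definite matrix, and let N be the unique element of L satisfying π_L(X⁻¹NX⁻¹) = π_L(X⁻¹). Then ‖N‖_X ≤ √n. -/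
/-- The quadratic form `V ↦ tr(A V A V)` is nonnegative on symmetric matrices when `A` is
positive semidefinite. -/
theorem trace_mul_mul_mul_nonneg_of_posSemidef {m : Type*} [Fintype m]
    {A V : Matrix m m ℝ} (hA : A.PosSemidef) (hV : V.IsSymm) :
    0 ≤ (A * V * A * V).trace := by
  classical
  obtain ⟨B, rfl⟩ : ∃ B : Matrix m m ℝ, A = B.conjTranspose * B := by
    open scoped MatrixOrder in
    exact CStarAlgebra.nonneg_iff_eq_star_mul_self.mp hA.nonneg
  have hV' : V.conjTranspose = V := by
    rw [Matrix.conjTranspose_eq_transpose_of_trivial, hV.eq]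
  have h := (Matrix.posSemidef_conjTranspose_mul_self
    (B * V * B.conjTranspose)).trace_nonneg
  have heq : (B.conjTranspose * B * V * (B.conjTranspose * B) * V).trace =
      ((B * V * B.conjTranspose).conjTranspose * (B * V * B.conjTranspose)).trace := by
    simp only [Matrix.conjTranspose_mul, Matrix.conjTranspose_conjTranspose, hV',
      Matrix.mul_assoc]
    rw [Matrix.trace_mul_comm]
    simp only [Matrix.mul_assoc]
  rwa [heq]

/-- The barrier parameter of the SDP barrier `-ln det` is at most `n`: if `N ∈ L` is the
Newton step at a symmetric positive definite `X`, i.e. the element of `L` with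
`π_L(X⁻¹ N X⁻¹) = π_L(X⁻¹)` (expressed by `X⁻¹ N X⁻¹ - X⁻¹` being orthogonal to `L`
in the trace inner product), then `‖N‖_X ≤ √n`. -/
theorem newton_step_norm_le_sqrt_n {n : ℕ}
    (L : Submodule ℝ (Matrix (Fin n) (Fin n) ℝ)) (hL : ∀ Y ∈ L, Y.IsSymm)
    (X : Matrix (Fin n) (Fin n) ℝ) (hX : X.PosDef)
    (N : Matrix (Fin n) (Fin n) ℝ) (hN : N ∈ L)
    (hNewton : ∀ Y ∈ L, ((X⁻¹ * N * X⁻¹ - X⁻¹) * Y).trace = 0) :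
    localNorm X N ≤ Real.sqrt n := by
  refine Real.sqrt_le_sqrt ?_
  have hN' : (X⁻¹ * N * X⁻¹ * N).trace = (X⁻¹ * N).trace := by
    have h := hNewton N hN
    rwa [Matrix.sub_mul, Matrix.trace_sub, sub_eq_zero] at h
  have hXsymm : X.IsSymm := by
    simpa [Matrix.IsHermitian, Matrix.IsSymm, Matrix.conjTranspose_eq_transpose_of_trivial]
      using hX.isHermitian
  have hnonneg := trace_mul_mul_mul_nonneg_of_posSemidef hX.inv.posSemidef
    ((hL N hN).sub hXsymm)
  have hinv : X⁻¹ * X = 1 := Matrix.nonsing_inv_mul X hX.det_pos.ne'.isUnit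
  have hexpand : X⁻¹ * (N - X) * X⁻¹ * (N - X) =
      X⁻¹ * N * X⁻¹ * N - X⁻¹ * N - X⁻¹ * N + 1 := by
    rw [Matrix.mul_assoc (X⁻¹ * (N - X)), Matrix.mul_sub, hinv, Matrix.mul_assoc (X⁻¹ * N)]
    noncomm_ring
  rw [hexpand, Matrix.trace_add, Matrix.trace_sub, Matrix.trace_sub, Matrix.trace_one,
    Fintype.card_fin, hN'] at hnonneg
  rw [hN']
  linarith
end

section
/- Let Z ∈ D be a minimizer of f over D and let X ∈ D satisfy ‖X - Z‖_X < 1. Then X⁺ = X + N(X) satisfies ‖X⁺ - Z‖_X ≤ ‖X - Z‖_X² / (1 - ‖X - Z‖_X). -/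
/-- The barrier `f(X) = -ln det X`. -/
noncomputable def barrier {n : ℕ} (X : Matrix (Fin n) (Fin n) ℝ) : ℝ :=
  -Real.log X.det

/-- The domain `D = {X : X ≻ 0, X - X₀ ∈ L}` of the barrier restricted to the affine
slice `X₀ + L`. -/
def barrierDomain {n : ℕ} (L : Submodule ℝ (Matrix (Fin n) (Fin n) ℝ))
    (X₀ : Matrix (Fin n) (Fin n) ℝ) : Set (Matrix (Fin n) (Fin n) ℝ) :=
  {X | X.PosDef ∧ X - X₀ ∈ L}

open Matrix Filter Topology in
/-- The identity perturbed by a small real symmetric matrix is positive definite. -/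
theorem posDef_one_add_of_sum_abs_lt_one {n : ℕ} {E : Matrix (Fin n) (Fin n) ℝ}
    (hE : E.IsSymm) (h : ∑ i, ∑ j, |E i j| < 1) : (1 + E).PosDef := by
  refine PosDef.of_dotProduct_mulVec_pos ?_ fun x hx => ?_
  · rw [IsHermitian, conjTranspose_eq_transpose_of_trivial, transpose_add, transpose_one, hE]
  have hs : 0 < x ⬝ᵥ x := by
    simpa using (dotProduct_star_self_pos_iff (v := x)).2 hx
  have hle : ∀ i, x i ^ 2 ≤ x ⬝ᵥ x := fun i => by
    simp only [dotProduct, ← pow_two]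
    exact Finset.single_le_sum (f := fun k => x k ^ 2) (fun k _ => sq_nonneg _)
      (Finset.mem_univ i)
  have habs : |x ⬝ᵥ (E *ᵥ x)| ≤ (∑ i, ∑ j, |E i j|) * (x ⬝ᵥ x) := by
    have hexp : x ⬝ᵥ (E *ᵥ x) = ∑ i, ∑ j, x i * (E i j * x j) := by
      simp only [mulVec, dotProduct, Finset.mul_sum]
    simp only [hexp, Finset.sum_mul]
    refine (Finset.abs_sum_le_sum_abs _ _).trans (Finset.sum_le_sum fun i _ => ?_)
    refine (Finset.abs_sum_le_sum_abs _ _).trans (Finset.sum_le_sum fun j _ => ?_)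
    have hij : |x i| * |x j| ≤ x ⬝ᵥ x := by
      nlinarith [hle i, hle j, sq_nonneg (|x i| - |x j|), sq_abs (x i), sq_abs (x j)]
    calc |x i * (E i j * x j)| = |E i j| * (|x i| * |x j|) := by rw [abs_mul, abs_mul]; ring
      _ ≤ |E i j| * (x ⬝ᵥ x) := mul_le_mul_of_nonneg_left hij (abs_nonneg _)
  have hlt := mul_lt_mul_of_pos_right h hs
  have := neg_abs_le (x ⬝ᵥ (E *ᵥ x))
  rw [star_trivial, add_mulVec, one_mulVec, dotProduct_add]
  linarith

open Matrix in
/-- A real positive definite matrix factors as `Bᵀ B` with `B` invertible. -/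
theorem Matrix.PosDef.exists_eq_transpose_mul_self {n : ℕ} {Z : Matrix (Fin n) (Fin n) ℝ}
    (hZ : Z.PosDef) : ∃ B C : Matrix (Fin n) (Fin n) ℝ, B * C = 1 ∧ C * B = 1 ∧ Z = Bᵀ * B := by
  open scoped MatrixOrder Matrix.Norms.L2Operator in
  obtain ⟨B, hB, h⟩ := CStarAlgebra.isStrictlyPositive_iff_eq_star_mul_self.mp
    hZ.isStrictlyPositive
  obtain ⟨u, rfl⟩ := hB
  exact ⟨u, ↑u⁻¹, u.mul_inv, u.inv_mul, by
    rw [h, star_eq_conjTranspose, conjTranspose_eq_transpose_of_trivial]⟩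

open Matrix Filter Topology in
/-- Positive definiteness is stable under small symmetric perturbations. -/
theorem Matrix.PosDef.eventually_add_smul {n : ℕ} {Z Y : Matrix (Fin n) (Fin n) ℝ}
    (hZ : Z.PosDef) (hY : Y.IsSymm) : ∀ᶠ t : ℝ in 𝓝 0, (Z + t • Y).PosDef := by
  obtain ⟨B, C, hBC, hCB, rfl⟩ := hZ.exists_eq_transpose_mul_self
  set E := Cᵀ * Y * C with hE
  have hEs : E.IsSymm := by
    rw [IsSymm, hE]; simp [transpose_mul, hY.eq, Matrix.mul_assoc]
  have hcont : Tendsto (fun t : ℝ => ∑ i, ∑ j, |(t • E) i j|) (𝓝 0) (𝓝 0) := by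
    have : Continuous (fun t : ℝ => ∑ i, ∑ j, |(t • E) i j|) := by
      simp only [smul_apply, smul_eq_mul]; fun_prop
    simpa using this.tendsto 0
  filter_upwards [hcont.eventually (gt_mem_nhds one_pos)] with t ht
  have hpd := posDef_one_add_of_sum_abs_lt_one (hEs.smul t) ht
  have hinj : Function.Injective B.mulVec :=
    mulVec_injective_of_isUnit ⟨⟨B, C, hBC, hCB⟩, rfl⟩
  have h := hpd.conjTranspose_mul_mul_same hinj
  have hBC' : Bᵀ * Cᵀ = 1 := by rw [← transpose_mul, hCB, transpose_one]
  have hY' : Bᵀ * E * B = Y := by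
    calc Bᵀ * E * B = (Bᵀ * Cᵀ) * Y * (C * B) := by simp only [hE, Matrix.mul_assoc]
      _ = Y := by rw [hBC', hCB, Matrix.one_mul, Matrix.mul_one]
  rwa [conjTranspose_eq_transpose_of_trivial, Matrix.mul_add, Matrix.add_mul, Matrix.mul_one,
    Matrix.mul_smul, Matrix.smul_mul, hY'] at h

open Matrix in
/-- Jacobi's formula at `t = 0`. -/
theorem Matrix.hasDerivAt_det_one_add_smul {n : ℕ} (M : Matrix (Fin n) (Fin n) ℝ) :
    HasDerivAt (fun t : ℝ => (1 + t • M).det) M.trace 0 := by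
  rw [funext fun t : ℝ => det_one_add_smul t M]
  set p := (det (1 + (Polynomial.X : Polynomial ℝ) • M.map Polynomial.C)).divX.divX
  have h1 := ((hasDerivAt_id (0 : ℝ)).const_mul M.trace).const_add 1
  have h2 := (p.hasDerivAt 0).mul ((hasDerivAt_id (0 : ℝ)).pow 2)
  refine (h1.add h2).congr_deriv ?_
  simp

open Matrix Filter Topology in
/-- First-order optimality: the gradient `-Z⁻¹` of the barrier at a minimizer over the slice
is orthogonal to `L`. -/
theorem trace_inv_mul_eq_zero_of_barrier_min {n : ℕ}
    {L : Submodule ℝ (Matrix (Fin n) (Fin n) ℝ)} {X₀ Z Y : Matrix (Fin n) (Fin n) ℝ}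
    (hZ : Z ∈ barrierDomain L X₀) (hZmin : ∀ W ∈ barrierDomain L X₀, barrier Z ≤ barrier W)
    (hY : Y ∈ L) (hYs : Y.IsSymm) : (Z⁻¹ * Y).trace = 0 := by
  have hdet := hZ.1.det_pos
  have hmax : IsLocalMax (fun t : ℝ => (1 + t • (Z⁻¹ * Y)).det) 0 := by
    filter_upwards [hZ.1.eventually_add_smul hYs] with t ht
    have hmem : Z + t • Y ∈ barrierDomain L X₀ :=
      ⟨ht, by rw [add_sub_right_comm]; exact L.add_mem hZ.2 (L.smul_mem t hY)⟩
    have hle : (Z + t • Y).det ≤ Z.det :=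
      (Real.log_le_log_iff ht.det_pos hdet).1 (neg_le_neg_iff.1 (hZmin _ hmem))
    have hfac : Z + t • Y = Z * (1 + t • (Z⁻¹ * Y)) := by
      rw [Matrix.mul_add, Matrix.mul_one, Matrix.mul_smul,
        mul_nonsing_inv_cancel_left _ _ hdet.ne'.isUnit]
    rw [hfac, det_mul] at hle
    simpa using le_of_mul_le_mul_left (hle.trans_eq (mul_one _).symm) hdet
  exact hmax.hasDerivAt_eq_zero (hasDerivAt_det_one_add_smul _)

open scoped Matrix Matrix.Norms.Frobenius in
/-- The Frobenius norm as an explicit square root. -/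
theorem Matrix.frobenius_norm_eq_sqrt {n : ℕ} (A : Matrix (Fin n) (Fin n) ℝ) :
    ‖A‖ = √(∑ p : Fin n × Fin n, A p.1 p.2 ^ 2) := by
  rw [Matrix.frobenius_norm_def, Real.sqrt_eq_rpow, Fintype.sum_prod_type]
  simp

open scoped Matrix Matrix.Norms.Frobenius in
/-- The trace form of a symmetric matrix with itself is its squared Frobenius norm. -/
theorem Matrix.IsSymm.trace_mul_self {n : ℕ} {A : Matrix (Fin n) (Fin n) ℝ}
    (hA : A.IsSymm) : (A * A).trace = ‖A‖ * ‖A‖ := by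
  rw [Matrix.frobenius_norm_eq_sqrt,
    Real.mul_self_sqrt (Finset.sum_nonneg fun p _ => sq_nonneg _), Fintype.sum_prod_type]
  refine Finset.sum_congr rfl fun i _ => ?_
  rw [Matrix.diag_apply, Matrix.mul_apply]
  exact Finset.sum_congr rfl fun j _ => by rw [hA.apply i j, pow_two]

open scoped Matrix Matrix.Norms.Frobenius in
/-- Cauchy–Schwarz for the trace form. -/
theorem Matrix.trace_mul_le_frobenius_norm {n : ℕ} (A B : Matrix (Fin n) (Fin n) ℝ) :
    (A * B).trace ≤ ‖A‖ * ‖B‖ := by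
  rw [← Matrix.frobenius_norm_transpose B, Matrix.frobenius_norm_eq_sqrt,
    Matrix.frobenius_norm_eq_sqrt]
  refine le_trans (le_of_eq ?_) (Real.sum_mul_le_sqrt_mul_sqrt Finset.univ
    (fun p : Fin n × Fin n => A p.1 p.2) (fun p => Bᵀ p.1 p.2))
  rw [Fintype.sum_prod_type]
  rfl

open scoped Matrix Matrix.Norms.Frobenius in
/-- The local norm at `BᵀB` is the Frobenius norm after conjugation by `C = B⁻¹`. -/
theorem localNorm_transpose_mul_self {n : ℕ} {B C V : Matrix (Fin n) (Fin n) ℝ}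
    (hinv : (Bᵀ * B)⁻¹ = C * Cᵀ) (hV : V.IsSymm) :
    localNorm (Bᵀ * B) V = ‖Cᵀ * V * C‖ := by
  have hs : (Cᵀ * V * C).IsSymm := by
    simp [Matrix.IsSymm, Matrix.transpose_mul, hV.eq, Matrix.mul_assoc]
  rw [← Real.sqrt_mul_self (norm_nonneg (Cᵀ * V * C)), ← hs.trace_mul_self, localNorm, hinv]
  congr 1
  calc (C * Cᵀ * V * (C * Cᵀ) * V).trace = (C * (Cᵀ * V * C * Cᵀ * V)).trace := by
        simp only [Matrix.mul_assoc]
    _ = (Cᵀ * V * C * (Cᵀ * V * C)).trace := by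
        rw [Matrix.trace_mul_comm]; simp only [Matrix.mul_assoc]

open scoped Matrix.Norms.Frobenius in
/-- Bound on the second-order remainder `1 - E - (1 + E)⁻¹`. -/
theorem Matrix.frobenius_norm_one_sub_sub_le {n : ℕ} {E G : Matrix (Fin n) (Fin n) ℝ}
    (hG : G * (1 + E) = 1) (hE : ‖E‖ < 1) : ‖1 - E - G‖ ≤ ‖E‖ ^ 2 / (1 - ‖E‖) := by
  rw [le_div_iff₀ (sub_pos.2 hE)]
  have hF : 1 - E - G = -(E * E) - (1 - E - G) * E := by
    have : G = 1 - G * E := by rw [← hG]; noncomm_ring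
    nth_rewrite 1 [this]
    noncomm_ring
  have h := norm_sub_le (-(E * E)) ((1 - E - G) * E)
  rw [← hF, norm_neg] at h
  nlinarith [Matrix.frobenius_norm_mul E E, Matrix.frobenius_norm_mul (1 - E - G) E]

/-- Renegar's Theorem 2.2.3 for the SDP barrier: if `Z` minimizes `f = -ln det` over `D`,
`X ∈ D` with `‖X - Z‖_X < 1`, and `N ∈ L` is the Newton step at `X`
(characterized by `π_L(X⁻¹ N X⁻¹) = π_L(X⁻¹)`), then
`‖(X + N) - Z‖_X ≤ ‖X - Z‖_X² / (1 - ‖X - Z‖_X)`. -/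
theorem newton_step_quadratic_convergence {n : ℕ}
    (L : Submodule ℝ (Matrix (Fin n) (Fin n) ℝ)) (hL : ∀ Y ∈ L, Y.IsSymm)
    (X₀ : Matrix (Fin n) (Fin n) ℝ) (hX₀ : X₀.PosDef)
    (Z : Matrix (Fin n) (Fin n) ℝ) (hZ : Z ∈ barrierDomain L X₀)
    (hZmin : ∀ W ∈ barrierDomain L X₀, barrier Z ≤ barrier W)
    (X : Matrix (Fin n) (Fin n) ℝ) (hXD : X ∈ barrierDomain L X₀)
    (N : Matrix (Fin n) (Fin n) ℝ) (hN : N ∈ L)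
    (hNewton : ∀ Y ∈ L, ((X⁻¹ * N * X⁻¹ - X⁻¹) * Y).trace = 0)
    (hclose : localNorm X (X - Z) < 1) :
    localNorm X ((X + N) - Z) ≤
      localNorm X (X - Z) ^ 2 / (1 - localNorm X (X - Z)) := by
  open scoped Matrix Matrix.Norms.Frobenius in
  have hΔL : Z - X ∈ L := by simpa using L.sub_mem hZ.2 hXD.2
  have hUL : X + N - Z ∈ L := by
    have : X + N - Z = N - (Z - X) := by abel
    exact this ▸ L.sub_mem hN hΔL
  have hopt := trace_inv_mul_eq_zero_of_barrier_min hZ hZmin hUL (hL _ hUL)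
  have hnewt := hNewton _ hUL
  have hZinv : Z⁻¹ * Z = 1 := Matrix.nonsing_inv_mul _ hZ.1.det_pos.ne'.isUnit
  obtain ⟨B, C, hBC, hCB, rfl⟩ := hXD.1.exists_eq_transpose_mul_self
  have hBC' : B.transpose * C.transpose = 1 := by
    rw [← Matrix.transpose_mul, hCB, Matrix.transpose_one]
  have hCB' : C.transpose * B.transpose = 1 := by
    rw [← Matrix.transpose_mul, hBC, Matrix.transpose_one]
  have hinv : (B.transpose * B)⁻¹ = C * C.transpose := by
    rw [Matrix.mul_inv_rev, Matrix.inv_eq_right_inv hBC, Matrix.inv_eq_right_inv hBC']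
  have hsymm : (B.transpose * B - Z).IsSymm := by
    rw [← neg_sub]; exact (hL _ hΔL).neg
  rw [localNorm_transpose_mul_self hinv hsymm] at hclose ⊢
  rw [localNorm_transpose_mul_self hinv (hL _ hUL)]
  set U := B.transpose * B + N - Z with hU
  set E := C.transpose * (Z - B.transpose * B) * C with hE
  set V := C.transpose * U * C with hV
  have hnormE : ‖C.transpose * (B.transpose * B - Z) * C‖ = ‖E‖ := by
    rw [hE, ← neg_sub (B.transpose * B) Z, Matrix.mul_neg, Matrix.neg_mul, norm_neg]
  rw [hnormE] at hclose ⊢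
  have hG : B * Z⁻¹ * B.transpose * (1 + E) = 1 := by
    have h1 : 1 + E = C.transpose * Z * C := by
      have : C.transpose * (B.transpose * B) * C = 1 := by
        rw [← Matrix.mul_assoc, hCB', Matrix.one_mul, hBC]
      rw [hE, Matrix.mul_sub, Matrix.sub_mul, this, add_sub_cancel]
    calc B * Z⁻¹ * B.transpose * (1 + E)
        = B * (Z⁻¹ * ((B.transpose * C.transpose) * Z)) * C := by
          rw [h1]; simp only [Matrix.mul_assoc]
      _ = 1 := by rw [hBC', Matrix.one_mul, hZinv, Matrix.mul_one, hBC]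
  refine le_trans ?_ (Matrix.frobenius_norm_one_sub_sub_le hG hclose)
  have hVs : V.IsSymm := by
    simp [hV, Matrix.IsSymm, Matrix.transpose_mul, (hL _ hUL).eq, Matrix.mul_assoc]
  have hcyc : ∀ M : Matrix (Fin n) (Fin n) ℝ,
      (C.transpose * M * C * V).trace = ((B.transpose * B)⁻¹ * M * (B.transpose * B)⁻¹ * U).trace := by
    intro M
    calc (C.transpose * M * C * V).trace = (C.transpose * M * C * C.transpose * U * C).trace := by
          simp only [hV, Matrix.mul_assoc]
      _ = _ := by rw [Matrix.trace_mul_comm, hinv]; simp only [Matrix.mul_assoc]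
  have hV1 : V.trace = ((B.transpose * B)⁻¹ * U).trace := by
    rw [hV, Matrix.trace_mul_comm, hinv, Matrix.mul_assoc]
  have hGV : (B * Z⁻¹ * B.transpose * V).trace = 0 := by
    have : B * Z⁻¹ * B.transpose * V = B * (Z⁻¹ * ((B.transpose * C.transpose) * U) * C) := by
      simp only [hV, Matrix.mul_assoc]
    rw [this, Matrix.trace_mul_comm, Matrix.mul_assoc, hCB, Matrix.mul_one, hBC',
      Matrix.one_mul, hopt]
  have hVV : (V * V).trace = ((1 - E - B * Z⁻¹ * B.transpose) * V).trace := by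
    have hUN : V = C.transpose * N * C - E := by
      rw [hV, hE, ← Matrix.sub_mul, ← Matrix.mul_sub]
      congr 2
      rw [hU]; abel
    rw [Matrix.sub_mul, Matrix.trace_sub] at hnewt
    nth_rewrite 1 [hUN]
    rw [Matrix.sub_mul, Matrix.sub_mul, Matrix.sub_mul, Matrix.trace_sub, Matrix.trace_sub,
      Matrix.trace_sub, hGV, Matrix.one_mul, hcyc, hV1]
    linarith
  have hCS := Matrix.trace_mul_le_frobenius_norm (1 - E - B * Z⁻¹ * B.transpose) V
  rw [← hVV] at hCS
  rcases (norm_nonneg V).eq_or_lt with h0 | h0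
  · rw [← h0]; exact norm_nonneg _
  · exact le_of_mul_le_mul_right (hVs.trace_mul_self ▸ hCS) h0
end

section
/- Let X ∈ D satisfy ‖N(X)‖_X < 1. Then X⁺ = X + N(X) lies in D and ‖N(X⁺)‖_{X⁺} ≤ (‖N(X)‖_X / (1 - ‖N(X)‖_X))². -/
open Matrix in
/-- A symmetric square matrix has nonnegative trace of its square. -/
theorem trace_mul_self_nonneg_of_isSymm {n : ℕ} {E : Matrix (Fin n) (Fin n) ℝ}
    (hE : E.IsSymm) : 0 ≤ (E * E).trace := by
  simp only [trace, diag_apply, mul_apply]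
  refine Finset.sum_nonneg fun i _ => Finset.sum_nonneg fun j _ => ?_
  rw [hE.apply i j]
  exact mul_self_nonneg _

open Matrix in
/-- `tr E⁴ ≤ (tr E²)²` for a symmetric matrix `E`. -/
theorem trace_sq_mul_sq_le_of_isSymm {n : ℕ} {E : Matrix (Fin n) (Fin n) ℝ}
    (hE : E.IsSymm) : (E * E * (E * E)).trace ≤ (E * E).trace ^ 2 := by
  have hEE : (E * E).IsSymm := by
    rw [IsSymm, transpose_mul, hE.eq]
  have h : (E * E).trace = ∑ i, ∑ k, E i k ^ 2 := by
    simp only [trace, diag_apply, mul_apply]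
    refine Finset.sum_congr rfl fun i _ => Finset.sum_congr rfl fun k _ => ?_
    rw [hE.apply i k, sq]
  calc (E * E * (E * E)).trace = ∑ i, ∑ j, (∑ k, E i k * E j k) ^ 2 := by
        simp only [trace, diag_apply]
        refine Finset.sum_congr rfl fun i _ => ?_
        rw [mul_apply]
        refine Finset.sum_congr rfl fun j _ => ?_
        rw [hEE.apply i j, ← sq, mul_apply]
        simp only [hE.apply]
    _ ≤ ∑ i, ∑ j, (∑ k, E i k ^ 2) * ∑ k, E j k ^ 2 :=
        Finset.sum_le_sum fun i _ => Finset.sum_le_sum fun j _ =>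
          Finset.sum_mul_sq_le_sq_mul_sq _ _ _
    _ = (E * E).trace ^ 2 := by
        rw [h, sq, Finset.sum_mul_sum]

open Matrix MatrixOrder in
/-- A positive definite matrix has an inverse of the form `Cᵀ C`. -/
theorem Matrix.PosDef.exists_inv_eq_transpose_mul_self {n : ℕ}
    {W : Matrix (Fin n) (Fin n) ℝ} (hW : W.PosDef) :
    ∃ C : Matrix (Fin n) (Fin n) ℝ, W⁻¹ = Cᵀ * C := by
  obtain ⟨C, hC⟩ := CStarAlgebra.nonneg_iff_eq_star_mul_self.mp hW.inv.posSemidef.nonneg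
  exact ⟨C, by rw [hC, star_eq_conjTranspose, conjTranspose_eq_transpose_of_trivial]⟩

open Matrix in
/-- The squared local norm of a symmetric matrix is nonnegative. -/
theorem Matrix.PosDef.trace_inv_mul_mul_inv_mul_nonneg {n : ℕ}
    {W V : Matrix (Fin n) (Fin n) ℝ} (hW : W.PosDef) (hV : V.IsSymm) :
    0 ≤ (W⁻¹ * V * W⁻¹ * V).trace := by
  obtain ⟨C, hC⟩ := hW.exists_inv_eq_transpose_mul_self
  have hE : (C * V * Cᵀ).IsSymm := by
    simp [IsSymm, transpose_mul, hV.eq, Matrix.mul_assoc]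
  have h := trace_mul_self_nonneg_of_isSymm hE
  rw [hC]
  rwa [show Cᵀ * C * V * (Cᵀ * C) * V = Cᵀ * (C * V * Cᵀ * C * V) by
      simp only [Matrix.mul_assoc], trace_mul_comm,
    show C * V * Cᵀ * C * V * Cᵀ = C * V * Cᵀ * (C * V * Cᵀ) by simp only [Matrix.mul_assoc]]

open Matrix in
/-- `tr (W⁻¹V)⁴ ≤ (tr (W⁻¹V)²)²` for symmetric `V` and positive definite `W`. -/
theorem Matrix.PosDef.trace_inv_mul_pow_four_le {n : ℕ}
    {W V : Matrix (Fin n) (Fin n) ℝ} (hW : W.PosDef) (hV : V.IsSymm) :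
    (W⁻¹ * V * W⁻¹ * V * (W⁻¹ * V * W⁻¹ * V)).trace ≤ (W⁻¹ * V * W⁻¹ * V).trace ^ 2 := by
  obtain ⟨C, hC⟩ := hW.exists_inv_eq_transpose_mul_self
  have hE : (C * V * Cᵀ).IsSymm := by
    simp [IsSymm, transpose_mul, hV.eq, Matrix.mul_assoc]
  have h := trace_sq_mul_sq_le_of_isSymm hE
  rw [hC]
  have h2 : (Cᵀ * C * V * (Cᵀ * C) * V).trace = (C * V * Cᵀ * (C * V * Cᵀ)).trace := by
    rw [show Cᵀ * C * V * (Cᵀ * C) * V = Cᵀ * (C * V * Cᵀ * C * V) by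
      simp only [Matrix.mul_assoc], trace_mul_comm]
    simp only [Matrix.mul_assoc]
  have h4 : (Cᵀ * C * V * (Cᵀ * C) * V * (Cᵀ * C * V * (Cᵀ * C) * V)).trace
      = (C * V * Cᵀ * (C * V * Cᵀ) * (C * V * Cᵀ * (C * V * Cᵀ))).trace := by
    rw [show Cᵀ * C * V * (Cᵀ * C) * V * (Cᵀ * C * V * (Cᵀ * C) * V)
        = Cᵀ * (C * V * Cᵀ * C * V * Cᵀ * C * V * Cᵀ * C * V) by
      simp only [Matrix.mul_assoc], trace_mul_comm]
    simp only [Matrix.mul_assoc]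
  rwa [h2, h4]

open Matrix in
/-- The open unit ball of the local norm at `X`, centred at `X`, consists of positive definite
matrices. -/
theorem Matrix.PosDef.add_of_trace_lt_one {n : ℕ}
    {X N : Matrix (Fin n) (Fin n) ℝ} (hX : X.PosDef) (hN : N.IsSymm)
    (hlt : (X⁻¹ * N * X⁻¹ * N).trace < 1) : (X + N).PosDef := by
  have hXs : Xᵀ = X := by
    have := hX.isHermitian.eq
    rwa [conjTranspose_eq_transpose_of_trivial] at this
  have hdet : IsUnit X.det := (Matrix.isUnit_iff_isUnit_det X).mp hX.isUnit
  refine Matrix.PosDef.of_dotProduct_mulVec_pos ?_ fun z hz => ?_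
  · rw [IsHermitian, conjTranspose_eq_transpose_of_trivial, transpose_add, hXs, hN.eq]
  have ha : 0 < z ⬝ᵥ (X *ᵥ z) := by simpa using hX.dotProduct_mulVec_pos hz
  set a := z ⬝ᵥ (X *ᵥ z)
  set b := z ⬝ᵥ (N *ᵥ z)
  set V := vecMulVec (X *ᵥ z) (X *ᵥ z) with hV_def
  have hVs : V.IsSymm := by
    rw [hV_def, IsSymm, transpose_vecMulVec]
  have hXV : X⁻¹ * V = vecMulVec z (X *ᵥ z) := by
    rw [hV_def, mul_vecMulVec, mulVec_mulVec, nonsing_inv_mul _ hdet, one_mulVec]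
  have hVV : (X⁻¹ * V * X⁻¹ * V).trace = a ^ 2 := by
    rw [Matrix.mul_assoc, hXV, vecMulVec_mul_vecMulVec, trace_vecMulVec, dotProduct_smul,
      dotProduct_comm (X *ᵥ z) z, smul_eq_mul, sq]
  have hNV : (X⁻¹ * N * X⁻¹ * V).trace = b := by
    rw [Matrix.mul_assoc, hXV, Matrix.mul_assoc, trace_mul_comm, mul_vecMulVec, vecMulVec_mul,
      ← mulVec_transpose, transpose_nonsing_inv, hXs, mulVec_mulVec,
      nonsing_inv_mul _ hdet, one_mulVec, trace_vecMulVec, dotProduct_comm]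
  have hVN : (X⁻¹ * V * X⁻¹ * N).trace = b := by
    rw [Matrix.mul_assoc, trace_mul_comm, ← Matrix.mul_assoc, hNV]
  have hq := hX.trace_inv_mul_mul_inv_mul_nonneg (hN.add (hVs.smul a⁻¹))
  have hexp : (X⁻¹ * (N + a⁻¹ • V) * X⁻¹ * (N + a⁻¹ • V)).trace
      = (X⁻¹ * N * X⁻¹ * N).trace + 2 * (a⁻¹ * b) + 1 := by
    simp only [Matrix.mul_add, Matrix.add_mul, Matrix.mul_smul, Matrix.smul_mul, trace_add,
      trace_smul, hVV, hNV, hVN, smul_eq_mul]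
    field_simp
    ring
  rw [hexp] at hq
  have hab : -1 < a⁻¹ * b := by linarith
  have : 0 < a + b := by
    have h := mul_lt_mul_of_pos_left hab ha
    rw [mul_inv_cancel_left₀ ha.ne'] at h
    linarith
  simpa [add_mulVec, dotProduct_add] using this


/-- Renegar's Theorem 2.2.4 for the SDP barrier: if `X ∈ D` has Newton step `N`
(characterized by `π_L(X⁻¹ N X⁻¹) = π_L(X⁻¹)`) with `‖N‖_X < 1`, then `X⁺ = X + N ∈ D`
and the Newton step `N'` at `X⁺` satisfies `‖N'‖_{X⁺} ≤ (‖N‖_X / (1 - ‖N‖_X))²`. -/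
theorem newton_step_iterate {n : ℕ}
    (L : Submodule ℝ (Matrix (Fin n) (Fin n) ℝ)) (hL : ∀ Y ∈ L, Y.IsSymm)
    (X₀ : Matrix (Fin n) (Fin n) ℝ) (hX₀ : X₀.PosDef)
    (X : Matrix (Fin n) (Fin n) ℝ) (hXD : X ∈ barrierDomain L X₀)
    (N : Matrix (Fin n) (Fin n) ℝ) (hN : N ∈ L)
    (hNewton : ∀ Y ∈ L, ((X⁻¹ * N * X⁻¹ - X⁻¹) * Y).trace = 0)
    (hsmall : localNorm X N < 1)
    (N' : Matrix (Fin n) (Fin n) ℝ) (hN' : N' ∈ L)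
    (hNewton' : ∀ Y ∈ L, (((X + N)⁻¹ * N' * (X + N)⁻¹ - (X + N)⁻¹) * Y).trace = 0) :
    X + N ∈ barrierDomain L X₀ ∧
      localNorm (X + N) N' ≤ (localNorm X N / (1 - localNorm X N)) ^ 2 := by
  obtain ⟨hX, hXL⟩ := hXD
  have hNs := hL N hN
  have hNns := hL N' hN'
  set d := (X⁻¹ * N * X⁻¹ * N).trace
  have hd0 : 0 ≤ d := hX.trace_inv_mul_mul_inv_mul_nonneg hNs
  have hd1 : d < 1 := by
    by_contra! h
    exact absurd hsmall (not_lt.mpr (Real.one_le_sqrt.mpr h))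
  have hW : (X + N).PosDef := hX.add_of_trace_lt_one hNs hd1
  refine ⟨⟨hW, ?_⟩, ?_⟩
  · rw [add_sub_right_comm]
    exact L.add_mem hXL hN
  have hXs : X.transpose = X := by
    have := hX.isHermitian.eq
    rwa [Matrix.conjTranspose_eq_transpose_of_trivial] at this
  have hXdet : IsUnit X.det := (Matrix.isUnit_iff_isUnit_det X).mp hX.isUnit
  have hWdet : IsUnit (X + N).det := (Matrix.isUnit_iff_isUnit_det _).mp hW.isUnit
  have hXX : X⁻¹ * X = 1 := Matrix.nonsing_inv_mul _ hXdet
  have hXXi : X * X⁻¹ = 1 := Matrix.mul_nonsing_inv _ hXdet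
  set W := X + N with hW_def
  have hWW : W⁻¹ * W = 1 := Matrix.nonsing_inv_mul _ hWdet
  have hWWi : W * W⁻¹ = 1 := Matrix.mul_nonsing_inv _ hWdet
  set A := X⁻¹ * N * X⁻¹ * N with hA
  have hHs : (W * A).IsSymm := by
    have h : W * A = N * X⁻¹ * N + N * X⁻¹ * N * X⁻¹ * N := by
      rw [hW_def, hA, Matrix.add_mul]
      simp only [← Matrix.mul_assoc, hXXi, Matrix.one_mul]
    rw [h]
    simp [Matrix.IsSymm, Matrix.transpose_mul, Matrix.transpose_nonsing_inv, hXs, hNs.eq,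
      Matrix.mul_assoc]
  have hWH : W⁻¹ * (W * A) = A := by rw [← Matrix.mul_assoc, hWW, Matrix.one_mul]
  have hres : A * W⁻¹ = W⁻¹ - X⁻¹ + X⁻¹ * N * X⁻¹ := by
    have h : A = (W⁻¹ - X⁻¹ + X⁻¹ * N * X⁻¹) * W := by
      rw [Matrix.add_mul, Matrix.sub_mul, hWW, hW_def, Matrix.mul_add, Matrix.mul_add,
        Matrix.mul_assoc _ X⁻¹ X, hXX, Matrix.mul_one]
      abel
    rw [h, Matrix.mul_assoc, hWWi, Matrix.mul_one]
  set t := (W⁻¹ * N' * W⁻¹ * N').trace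
  have hcross : (A * W⁻¹ * N').trace = t := by
    have h1 := hNewton N' hN'
    have h2 := hNewton' N' hN'
    rw [hres]
    simp only [Matrix.sub_mul, Matrix.add_mul, Matrix.trace_sub, Matrix.trace_add] at h1 h2 ⊢
    linarith
  have hq := hW.trace_inv_mul_mul_inv_mul_nonneg (hNns.sub hHs)
  have hc1 : (W⁻¹ * N' * W⁻¹ * (W * A)).trace = t := by
    rw [Matrix.mul_assoc _ W⁻¹, hWH, Matrix.trace_mul_comm, ← Matrix.mul_assoc, hcross]
  have hexp : (W⁻¹ * (N' - W * A) * W⁻¹ * (N' - W * A)).trace = (A * A).trace - t := by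
    simp only [Matrix.mul_sub, Matrix.sub_mul, Matrix.trace_sub, hWH, hc1, hcross]
    rw [Matrix.mul_assoc A, hWH]
    ring
  have ht2 : t ≤ d ^ 2 := by
    have := hX.trace_inv_mul_pow_four_le hNs
    rw [hexp] at hq
    exact (sub_nonneg.mp hq).trans this
  have hδ : localNorm X N = Real.sqrt d := rfl
  rw [hδ] at hsmall ⊢
  have hδ0 := Real.sqrt_nonneg d
  calc localNorm W N' ≤ Real.sqrt (d ^ 2) := Real.sqrt_le_sqrt ht2
    _ = Real.sqrt d ^ 2 := by rw [Real.sqrt_sq hd0, Real.sq_sqrt hd0]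
    _ ≤ (Real.sqrt d / (1 - Real.sqrt d)) ^ 2 := by
        gcongr
        exact le_div_self hδ0 (by linarith) (by linarith)
end

section
/- Let ϑ ≥ 1, η₁ > 0, and ε > 0 be real numbers, and let k be a positive integer with k ≥ 10·√ϑ·ln(7ϑ/(6·η₁·ε)). Then η₁·(1 + 1/(8√ϑ))^{k-1} ≥ ϑ/ε. In particular, in the short-step algorithm with η_{j+1} = (1 + 1/(8√ϑ))·η_j, after at most ⌈10√ϑ·ln(7ϑ/(6η₁ε))⌉ iterations the stopping criterion ϑ/η_k ≤ ε is met. -/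
/-- Iteration-count bound for the short-step interior point method (Nesterov–Nemirovski):
if `ϑ ≥ 1`, `η₁ > 0`, `ε > 0` and `k ≥ 1` with `k ≥ 10 √ϑ ln(7ϑ/(6 η₁ ε))`, then
`η₁ (1 + 1/(8√ϑ))^{k-1} ≥ ϑ/ε`; i.e. after at most `⌈10 √ϑ ln(7ϑ/(6 η₁ ε))⌉` iterations
of the update `η ← (1 + 1/(8√ϑ)) η` the stopping criterion `ϑ/η ≤ ε` is met. -/
theorem short_step_iteration_bound (ϑ η₁ ε : ℝ) (hϑ : 1 ≤ ϑ) (hη : 0 < η₁) (hε : 0 < ε)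
    (k : ℕ) (hk : 0 < k)
    (hkge : 10 * Real.sqrt ϑ * Real.log (7 * ϑ / (6 * η₁ * ε)) ≤ (k : ℝ)) :
    ϑ / ε ≤ η₁ * (1 + 1 / (8 * Real.sqrt ϑ)) ^ (k - 1) := by
  set s := √ϑ
  have hs : 1 ≤ s := Real.one_le_sqrt.mpr hϑ
  have hx : 0 < 1 / (8 * s) := by positivity
  have hx' : 1 / (8 * s) ≤ 1 / 8 := one_div_le_one_div_of_le (by norm_num) (by linarith)
  set x := 1 / (8 * s)
  have hsx : 10 * s * (4 / 5 * x) = 1 := by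
    simp only [x]
    field_simp
    norm_num
  have hlower : 4 / 5 * x ≤ Real.log (1 + x) := by
    refine le_trans ?_ (Real.le_log_one_add_of_nonneg hx.le)
    rw [le_div_iff₀ (by positivity)]
    nlinarith
  have hupper : Real.log (1 + x) ≤ Real.log (7 / 6) :=
    Real.log_le_log (by positivity) (by linarith)
  have hϑ₀ : 0 < ϑ := by linarith
  have hsplit : Real.log (7 * ϑ / (6 * η₁ * ε)) = Real.log (7 / 6) + Real.log (ϑ / ε / η₁) := by
    rw [← Real.log_mul (by norm_num) (by positivity)]
    congr 1
    field_simp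
  have hk_log : Real.log (7 / 6) + Real.log (ϑ / ε / η₁) ≤ k * Real.log (1 + x) := by
    rw [← hsplit]
    calc Real.log (7 * ϑ / (6 * η₁ * ε))
        = 10 * s * Real.log (7 * ϑ / (6 * η₁ * ε)) * (4 / 5 * x) := by
          linear_combination -Real.log (7 * ϑ / (6 * η₁ * ε)) * hsx
      _ ≤ k * Real.log (1 + x) := by gcongr
  rw [← div_le_iff₀' hη, ← Real.log_le_log_iff (by positivity) (by positivity), Real.log_pow,
    Nat.cast_pred hk]
  linarith
end

section
/- Let n ≥ 1, let X₀ be an n×n real symmetric positive definite matrix whose smallest eigenvalue σ satisfies σ ≥ r for some real r > 0, let C be an n×n real symmetric matrix, and set S₀ := C + 2‖C‖_∞·I, where ‖C‖_∞ = max_{i} ∑_{j=1}^n |C_{ij}| is the maximum absolute row sum of C. Assume S₀ is positive definite with det S₀ ≥ 1, and let η > 0. Then every n×n real symmetric positive definite matrix S satisfying ⟨X₀, S⟩ - (1/η)·ln det S ≤ ⟨X₀, S₀⟩ - (1/η)·ln det S₀ satisfies ‖S‖_F ≤ (√n / ((1 - 1/e)·r)) · (⟨X₀, S₀⟩ + n/(r·η²)).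 -/
/-- The Frobenius norm `‖V‖_F = (tr(V²))^{1/2}` of a symmetric matrix `V`. -/
noncomputable def frobNorm {n : ℕ} (V : Matrix (Fin n) (Fin n) ℝ) : ℝ :=
  Real.sqrt ((V * V).trace)

/-- The maximum absolute row sum norm `‖C‖_∞ = maxᵢ ∑ⱼ |C_{ij}|` (for `n ≥ 1`). -/
noncomputable def maxRowSum {n : ℕ} [NeZero n] (C : Matrix (Fin n) (Fin n) ℝ) : ℝ :=
  Finset.univ.sup' Finset.univ_nonempty fun i => ∑ j, |C i j|

/-- The trace of a product of two real positive semidefinite matrices is nonnegative. -/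
theorem Matrix.PosSemidef.trace_mul_nonneg {n : Type*} [Fintype n] {A B : Matrix n n ℝ}
    (hA : A.PosSemidef) (hB : B.PosSemidef) : 0 ≤ (A * B).trace := by
  obtain ⟨m, v, rfl⟩ := Matrix.posSemidef_iff_eq_sum_vecMulVec.mp hB
  rw [Matrix.mul_sum, Matrix.trace_sum]
  refine Finset.sum_nonneg fun i _ => ?_
  rw [Matrix.mul_vecMulVec, Matrix.trace_vecMulVec, dotProduct_comm]
  exact hA.dotProduct_mulVec_nonneg (v i)

/-- The trace of the square of a symmetric matrix is the sum of its squared eigenvalues. -/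
theorem Matrix.IsHermitian.trace_mul_self {n : Type*} [Fintype n] [DecidableEq n]
    {A : Matrix n n ℝ} (hA : A.IsHermitian) : (A * A).trace = ∑ i, hA.eigenvalues i ^ 2 := by
  conv_lhs => rw [hA.spectral_theorem, ← map_mul, Unitary.conjStarAlgAut_apply,
    Matrix.trace_mul_cycle, Unitary.coe_star_mul_self, one_mul, Matrix.diagonal_mul_diagonal,
    Matrix.trace_diagonal]
  simp [sq]

theorem frobNorm_le_trace {n : ℕ} {S : Matrix (Fin n) (Fin n) ℝ} (hS : S.PosSemidef) :
    frobNorm S ≤ S.trace := by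
  refine Real.sqrt_le_iff.mpr ⟨hS.trace_nonneg, ?_⟩
  rw [hS.1.trace_mul_self, hS.1.trace_eq_sum_eigenvalues]
  exact Finset.sum_sq_le_sq_sum_of_nonneg fun i _ => hS.eigenvalues_nonneg i

/-- A tangent-line bound for the logarithm: the tangent is taken at `e / (η r)`. -/
theorem log_div_le_linear {r η x : ℝ} (hr : 0 < r) (hη : 0 < η) (hx : 0 < x) :
    1 / η * Real.log x ≤ r * x / Real.exp 1 + 1 / (r * η ^ 2) := by
  have hy : 0 < η * r := by positivity
  have h₁ := Real.log_le_sub_one_of_pos (x := x * (η * r) / Real.exp 1) (by positivity)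
  rw [Real.log_div (by positivity) (by positivity), Real.log_mul hx.ne' hy.ne',
    Real.log_exp] at h₁
  have h₂ := Real.log_le_self (x := (η * r)⁻¹) (by positivity)
  rw [Real.log_inv] at h₂
  have h₃ : Real.log x ≤ x * (η * r) / Real.exp 1 + (η * r)⁻¹ := by linarith
  calc 1 / η * Real.log x ≤ 1 / η * (x * (η * r) / Real.exp 1 + (η * r)⁻¹) := by gcongr
    _ = r * x / Real.exp 1 + 1 / (r * η ^ 2) := by field_simp

theorem log_det_le_trace {n : ℕ} {S : Matrix (Fin n) (Fin n) ℝ} (hS : S.PosDef)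
    {r η : ℝ} (hr : 0 < r) (hη : 0 < η) :
    1 / η * Real.log S.det ≤ r * S.trace / Real.exp 1 + n / (r * η ^ 2) := by
  have hdet : S.det = ∏ i, hS.1.eigenvalues i := hS.1.det_eq_prod_eigenvalues
  have htr : S.trace = ∑ i, hS.1.eigenvalues i := hS.1.trace_eq_sum_eigenvalues
  rw [hdet, htr, Real.log_prod fun i _ => (hS.eigenvalues_pos i).ne', Finset.mul_sum]
  refine (Finset.sum_le_sum fun i _ => log_div_le_linear hr hη (hS.eigenvalues_pos i)).trans_eq ?_
  rw [Finset.sum_add_distrib, ← Finset.sum_div, ← Finset.mul_sum]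
  simp [div_eq_mul_inv]

/-- Core of the dual central path bound (Lemma 1 of the paper): if the smallest eigenvalue
of the symmetric positive definite `X₀` is at least `r > 0` (expressed as `X₀ - r·I ⪰ 0`),
`S₀ = C + 2‖C‖_∞ I` is positive definite with `det S₀ ≥ 1`, and `η > 0`, then every
symmetric positive definite `S` with
`⟨X₀,S⟩ - (1/η) ln det S ≤ ⟨X₀,S₀⟩ - (1/η) ln det S₀` satisfies
`‖S‖_F ≤ (√n/((1-1/e) r)) (⟨X₀,S₀⟩ + n/(r η²))`. -/
theorem dual_central_path_bound {n : ℕ} [NeZero n]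
    (X₀ : Matrix (Fin n) (Fin n) ℝ) (hX₀ : X₀.PosDef) (hX₀s : X₀.IsSymm)
    (r : ℝ) (hr : 0 < r) (hσ : (X₀ - r • (1 : Matrix (Fin n) (Fin n) ℝ)).PosSemidef)
    (C : Matrix (Fin n) (Fin n) ℝ) (hC : C.IsSymm) (η : ℝ) (hη : 0 < η)
    (S₀ : Matrix (Fin n) (Fin n) ℝ)
    (hS₀def : S₀ = C + (2 * maxRowSum C) • (1 : Matrix (Fin n) (Fin n) ℝ))
    (hS₀ : S₀.PosDef) (hS₀det : 1 ≤ S₀.det)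
    (S : Matrix (Fin n) (Fin n) ℝ) (hS : S.PosDef) (hSs : S.IsSymm)
    (hpot : (X₀ * S).trace - (1 / η) * Real.log S.det ≤
      (X₀ * S₀).trace - (1 / η) * Real.log S₀.det) :
    frobNorm S ≤ Real.sqrt n / ((1 - 1 / Real.exp 1) * r) *
      ((X₀ * S₀).trace + n / (r * η ^ 2)) := by
  have hX : r * S.trace ≤ (X₀ * S).trace := by
    have h := hσ.trace_mul_nonneg hS.posSemidef
    rw [sub_mul, Matrix.trace_sub, smul_mul_assoc, one_mul, Matrix.trace_smul, smul_eq_mul] at h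
    linarith
  have hlog : 0 ≤ 1 / η * Real.log S₀.det := mul_nonneg (by positivity) (Real.log_nonneg hS₀det)
  have hc : 0 < (1 - 1 / Real.exp 1) * r := by
    refine mul_pos (sub_pos.mpr ?_) hr
    rw [div_lt_one (Real.exp_pos 1)]
    exact Real.one_lt_exp_iff.mpr one_pos
  have hmain : (1 - 1 / Real.exp 1) * r * S.trace ≤ (X₀ * S₀).trace + n / (r * η ^ 2) := by
    have h := log_det_le_trace hS hr hη
    have heq : (1 - 1 / Real.exp 1) * r * S.trace =
        r * S.trace - r * S.trace / Real.exp 1 := by ring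
    linarith
  have hn : 1 ≤ Real.sqrt n := Real.one_le_sqrt.mpr (by exact_mod_cast NeZero.one_le)
  have htr : 0 ≤ S.trace := hS.posSemidef.trace_nonneg
  calc frobNorm S ≤ S.trace := frobNorm_le_trace hS.posSemidef
    _ ≤ Real.sqrt n * S.trace := le_mul_of_one_le_left htr hn
    _ = Real.sqrt n / ((1 - 1 / Real.exp 1) * r) * ((1 - 1 / Real.exp 1) * r * S.trace) := by
      rw [← mul_assoc, div_mul_cancel₀ _ hc.ne']
    _ ≤ _ := by gcongr
end

section
/- Let X and Z be n×n real symmetric positive definite matrices, let Δ be an n×n real symmetric matrix, and let 0 < ε̃ < 1 and c' > 0 be real numbers with ‖Δ‖_X ≤ ε̃ and ‖X - Z‖_X ≤ c'. Then X + Δ is positive definite and ‖(X + Δ) - Z‖_{X+Δ} ≤ (c' + ε̃)/(1 - ε̃). In particular, if ε̃ = 1/16 and c' = 1/32 then ‖(X + Δ) - Z‖_{X+Δ} ≤ 1/10. -/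
open Matrix

theorem exists_orthogonal_diagonalization {n : ℕ} {H : Matrix (Fin n) (Fin n) ℝ}
    (hH : H.IsHermitian) :
    ∃ U : Matrix (Fin n) (Fin n) ℝ, Uᵀ * U = 1 ∧ Uᵀ * H * U = diagonal hH.eigenvalues := by
  have hU : (hH.eigenvectorUnitary : Matrix (Fin n) (Fin n) ℝ)ᵀ * hH.eigenvectorUnitary = 1 := by
    have := Unitary.coe_star_mul_self hH.eigenvectorUnitary
    rwa [star_eq_conjTranspose, conjTranspose_eq_transpose_of_trivial] at this
  refine ⟨hH.eigenvectorUnitary, hU, ?_⟩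
  have h := hH.spectral_theorem
  rw [Unitary.conjStarAlgAut_apply, star_eq_conjTranspose,
    conjTranspose_eq_transpose_of_trivial] at h
  calc (hH.eigenvectorUnitary : Matrix (Fin n) (Fin n) ℝ)ᵀ * H * hH.eigenvectorUnitary
      = _ := congrArg (fun A => (hH.eigenvectorUnitary : Matrix (Fin n) (Fin n) ℝ)ᵀ * A *
          hH.eigenvectorUnitary) h
    _ = diagonal hH.eigenvalues := by
      simp only [← mul_assoc, hU, one_mul]
      rw [mul_assoc, hU, mul_one]
      rfl

/-- A positive definite matrix and a symmetric matrix are diagonalized by a common congruence,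
which takes the former to the identity. -/
theorem exists_simultaneous_congruence {n : ℕ} {X Y : Matrix (Fin n) (Fin n) ℝ}
    (hX : X.PosDef) (hY : Y.IsSymm) :
    ∃ (P : Matrix (Fin n) (Fin n) ℝ) (d : Fin n → ℝ),
      IsUnit P ∧ Pᵀ * X * P = 1 ∧ Pᵀ * Y * P = diagonal d := by
  obtain ⟨U, -, hUX⟩ := exists_orthogonal_diagonalization hX.isHermitian
  set s : Matrix (Fin n) (Fin n) ℝ := diagonal fun i => (√(hX.isHermitian.eigenvalues i))⁻¹
  have hsX : (U * s)ᵀ * X * (U * s) = 1 := by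
    calc (U * s)ᵀ * X * (U * s) = sᵀ * (Uᵀ * X * U) * s := by
          simp only [transpose_mul, mul_assoc]
      _ = 1 := by
          rw [hUX, diagonal_transpose, diagonal_mul_diagonal, diagonal_mul_diagonal,
            ← diagonal_one]
          congr 1
          ext i
          have hpos := hX.eigenvalues_pos i
          have := Real.sqrt_pos.2 hpos
          field_simp
          rw [Real.sq_sqrt hpos.le]
  have hH : ((U * s)ᵀ * Y * (U * s)).IsHermitian := by
    rw [IsHermitian, conjTranspose_eq_transpose_of_trivial]
    simp only [transpose_mul, transpose_transpose, hY.eq, mul_assoc]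
  obtain ⟨V, hV, hVY⟩ := exists_orthogonal_diagonalization hH
  have hPX : (U * s * V)ᵀ * X * (U * s * V) = 1 := by
    calc (U * s * V)ᵀ * X * (U * s * V) = Vᵀ * ((U * s)ᵀ * X * (U * s)) * V := by
          simp only [transpose_mul, mul_assoc]
      _ = 1 := by rw [hsX, mul_one, hV]
  refine ⟨U * s * V, hH.eigenvalues, .of_mul_eq_one_right _ hPX, hPX, ?_⟩
  rw [← hVY]
  simp only [transpose_mul, mul_assoc]

theorem localNorm_congruence {n : ℕ} {P : Matrix (Fin n) (Fin n) ℝ} (hP : IsUnit P)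
    (W V : Matrix (Fin n) (Fin n) ℝ) :
    localNorm (Pᵀ * W * P) (Pᵀ * V * P) = localNorm W V := by
  have hdet := (isUnit_iff_isUnit_det P).1 hP
  have hdetT : IsUnit Pᵀ.det := by rwa [det_transpose]
  unfold localNorm
  congr 1
  calc ((Pᵀ * W * P)⁻¹ * (Pᵀ * V * P) * (Pᵀ * W * P)⁻¹ * (Pᵀ * V * P)).trace
      = (P⁻¹ * (W⁻¹ * V * W⁻¹ * V * P)).trace := by
        simp only [Matrix.mul_inv_rev, mul_assoc, nonsing_inv_mul_cancel_left _ _ hdetT,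
          mul_nonsing_inv_cancel_left _ _ hdet]
    _ = (W⁻¹ * V * W⁻¹ * V).trace := by
        rw [trace_mul_comm, mul_nonsing_inv_cancel_right _ _ hdet]

theorem localNorm_diagonal_s13 {n : ℕ} {w : Fin n → ℝ} (hw : ∀ i, w i ≠ 0)
    {V : Matrix (Fin n) (Fin n) ℝ} (hV : V.IsSymm) :
    localNorm (diagonal w) V = √(∑ i, ∑ j, V i j ^ 2 / (w i * w j)) := by
  have hinv : (diagonal w)⁻¹ = diagonal fun i => (w i)⁻¹ :=
    inv_eq_right_inv <| by simp [diagonal_mul_diagonal, hw]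
  rw [localNorm, hinv, mul_assoc (_ * V)]
  congr 1
  simp only [trace, diag_apply, mul_apply (M := diagonal _ * V), diagonal_mul]
  refine Finset.sum_congr rfl fun i _ => Finset.sum_congr rfl fun j _ => ?_
  rw [hV.apply i j]
  ring

theorem localNorm_one {n : ℕ} {V : Matrix (Fin n) (Fin n) ℝ} (hV : V.IsSymm) :
    localNorm 1 V = √(∑ i, ∑ j, V i j ^ 2) := by
  rw [← diagonal_one, localNorm_diagonal_s13 (by simp) hV]
  simp

open scoped Matrix.Norms.Frobenius in
theorem localNorm_one_add_le {n : ℕ} {V W : Matrix (Fin n) (Fin n) ℝ} (hV : V.IsSymm)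
    (hW : W.IsSymm) : localNorm 1 (V + W) ≤ localNorm 1 V + localNorm 1 W := by
  have hnorm {A : Matrix (Fin n) (Fin n) ℝ} (hA : A.IsSymm) : localNorm 1 A = ‖A‖ := by
    simp [localNorm_one hA, frobenius_norm_def, Real.sqrt_eq_rpow]
  rw [hnorm hV, hnorm hW, hnorm (hV.add hW)]
  exact norm_add_le V W

theorem abs_le_localNorm_one_diagonal {n : ℕ} (d : Fin n → ℝ) (i : Fin n) :
    |d i| ≤ localNorm 1 (diagonal d) := by
  rw [localNorm_one (isSymm_diagonal d), ← Real.sqrt_sq_eq_abs]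
  refine Real.sqrt_le_sqrt ?_
  calc d i ^ 2 = diagonal d i i ^ 2 := by rw [diagonal_apply_eq]
    _ ≤ ∑ j, diagonal d i j ^ 2 :=
      Finset.single_le_sum (f := fun j => diagonal d i j ^ 2) (fun _ _ => sq_nonneg _)
        (Finset.mem_univ i)
    _ ≤ ∑ k, ∑ j, diagonal d k j ^ 2 :=
      Finset.single_le_sum (f := fun k => ∑ j, diagonal d k j ^ 2)
        (fun _ _ => Finset.sum_nonneg fun _ _ => sq_nonneg _) (Finset.mem_univ i)

theorem localNorm_diagonal_le {n : ℕ} {w : Fin n → ℝ} {r : ℝ} (hr : 0 < r) (hw : ∀ i, r ≤ w i)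
    {V : Matrix (Fin n) (Fin n) ℝ} (hV : V.IsSymm) :
    localNorm (diagonal w) V ≤ localNorm 1 V / r := by
  rw [localNorm_diagonal_s13 (fun i => (hr.trans_le (hw i)).ne') hV, localNorm_one hV]
  refine Real.sqrt_le_iff.2 ⟨by positivity, ?_⟩
  rw [div_pow, Real.sq_sqrt (by positivity), Finset.sum_div]
  simp only [Finset.sum_div]
  gcongr with i _ j _
  rw [sq r]
  exact mul_le_mul (hw i) (hw j) hr.le (hr.le.trans (hw i))


/-- Rounding keeps the iterate close to the central path: if `X, Z` are symmetric positive
definite, `Δ` is symmetric, `0 < ε̃ < 1`, `c' > 0`, `‖Δ‖_X ≤ ε̃` and `‖X - Z‖_X ≤ c'`,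
then `X + Δ` is positive definite and `‖(X + Δ) - Z‖_{X+Δ} ≤ (c' + ε̃)/(1 - ε̃)`;
in particular for `ε̃ = 1/16`, `c' = 1/32` the bound is `1/10`. -/
theorem rounding_stays_close {n : ℕ} (X Z : Matrix (Fin n) (Fin n) ℝ)
    (hX : X.PosDef) (hZ : Z.PosDef) (Δ : Matrix (Fin n) (Fin n) ℝ) (hΔs : Δ.IsSymm)
    (ε' c' : ℝ) (hε0 : 0 < ε') (hε1 : ε' < 1) (hc' : 0 < c')
    (hΔ : localNorm X Δ ≤ ε') (hXZ : localNorm X (X - Z) ≤ c') :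
    (X + Δ).PosDef ∧ localNorm (X + Δ) ((X + Δ) - Z) ≤ (c' + ε') / (1 - ε') ∧
      (ε' = 1 / 16 → c' = 1 / 32 → localNorm (X + Δ) ((X + Δ) - Z) ≤ 1 / 10) := by
  have hZX : (X - Z).IsSymm := by
    have := (hX.isHermitian.sub hZ.isHermitian).eq
    rwa [conjTranspose_eq_transpose_of_trivial] at this
  obtain ⟨P, d, hP, hPX, hPΔ⟩ := exists_simultaneous_congruence hX hΔs
  have hsum : Pᵀ * (X + Δ) * P = diagonal (1 + d) := by
    rw [mul_add, add_mul, hPX, hPΔ, ← diagonal_one, diagonal_add]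
    rfl
  have hΔ' : localNorm 1 (diagonal d) ≤ ε' := by
    rwa [← hPX, ← hPΔ, localNorm_congruence hP]
  have hXZ' : localNorm 1 (Pᵀ * (X - Z) * P) ≤ c' := by
    rwa [← hPX, localNorm_congruence hP]
  have hd : ∀ i, 1 - ε' ≤ (1 + d) i := fun i => by
    have := (abs_le.1 ((abs_le_localNorm_one_diagonal d i).trans hΔ')).1
    rw [Pi.add_apply, Pi.one_apply]
    linarith
  have hr : 0 < 1 - ε' := sub_pos.2 hε1
  have hpos : (X + Δ).PosDef := by
    rw [← IsUnit.posDef_star_left_conjugate_iff hP, star_eq_conjTranspose,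
      conjTranspose_eq_transpose_of_trivial, hsum]
    exact PosDef.diagonal fun i => hr.trans_le (hd i)
  have hsymm : (Pᵀ * (X - Z) * P).IsSymm := by
    rw [IsSymm]
    simp only [transpose_mul, transpose_transpose, hZX.eq, mul_assoc]
  have hdiff : Pᵀ * ((X + Δ) - Z) * P = Pᵀ * (X - Z) * P + diagonal d := by
    rw [← hPΔ, ← add_mul, ← mul_add]
    congr 2
    abel
  have hbound : localNorm (X + Δ) ((X + Δ) - Z) ≤ (c' + ε') / (1 - ε') := by
    rw [← localNorm_congruence hP, hsum, hdiff]
    refine (localNorm_diagonal_le hr hd (hsymm.add (isSymm_diagonal d))).trans ?_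
    gcongr
    exact (localNorm_one_add_le hsymm (isSymm_diagonal d)).trans (add_le_add hXZ' hΔ')
  refine ⟨hpos, hbound, fun hε hc => hbound.trans_eq ?_⟩
  rw [hε, hc]
  norm_num
end

section
/- Let X and Z be n×n real symmetric positive definite matrices with ‖Z - X‖_X ≤ 1/32. Then for every n×n real symmetric matrix Δ one has ‖Δ‖_X ≤ (31/30)·‖Δ‖_Z. -/
namespace Matrix

variable {m : Type*} [Fintype m] [DecidableEq m]

open scoped MatrixOrder Matrix.Norms.L2Operator in
/-- A real positive semidefinite matrix is a Gram matrix. -/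
theorem PosSemidef.exists_eq_conjTranspose_mul_self {A : Matrix m m ℝ} (hA : A.PosSemidef) :
    ∃ R : Matrix m m ℝ, A = R.conjTranspose * R :=
  CStarAlgebra.nonneg_iff_eq_star_mul_self.mp hA.nonneg

/-- The trace of a product of two positive semidefinite matrices is nonnegative. -/
theorem PosSemidef.trace_mul_nonneg_real {P Q : Matrix m m ℝ}
    (hP : P.PosSemidef) (hQ : Q.PosSemidef) : 0 ≤ (P * Q).trace := by
  obtain ⟨R, rfl⟩ := hQ.exists_eq_conjTranspose_mul_self
  rw [← Matrix.mul_assoc, trace_mul_comm, ← Matrix.mul_assoc]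
  exact (hP.mul_mul_conjTranspose_same R).trace_nonneg

/-- A symmetric matrix is bounded above by any upper bound of its Frobenius norm. -/
theorem IsHermitian.posSemidef_smul_one_sub {F : Matrix m m ℝ} (hF : F.IsHermitian)
    {t : ℝ} (ht : 0 ≤ t) (h : (F * F).trace ≤ t ^ 2) :
    (t • (1 : Matrix m m ℝ) - F).PosSemidef := by
  refine .of_dotProduct_mulVec_nonneg ((isHermitian_one.smul (IsSelfAdjoint.all t)).sub hF)
    fun x => ?_
  have hsq : ∑ p : m × m, F p.1 p.2 ^ 2 ≤ t ^ 2 := by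
    refine le_of_eq_of_le ?_ h
    rw [Fintype.sum_prod_type]
    simp only [trace, diag_apply, mul_apply]
    refine Finset.sum_congr rfl fun i _ => Finset.sum_congr rfl fun j _ => ?_
    rw [sq, ← hF.apply j i, star_trivial]
  have hx : ∑ p : m × m, (x p.1 * x p.2) ^ 2 = (x ⬝ᵥ x) ^ 2 := by
    rw [Fintype.sum_prod_type, sq, dotProduct, Finset.sum_mul_sum]
    exact Finset.sum_congr rfl fun i _ => Finset.sum_congr rfl fun j _ => by ring
  have hform : ∑ p : m × m, F p.1 p.2 * (x p.1 * x p.2) = x ⬝ᵥ F *ᵥ x := by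
    rw [Fintype.sum_prod_type]
    simp only [dotProduct, mulVec, Finset.mul_sum]
    exact Finset.sum_congr rfl fun i _ => Finset.sum_congr rfl fun j _ => by ring
  have hcs := Finset.sum_mul_sq_le_sq_mul_sq Finset.univ (fun p : m × m => F p.1 p.2)
    (fun p => x p.1 * x p.2)
  rw [hform, hx] at hcs
  have hnn : 0 ≤ x ⬝ᵥ x := Finset.sum_nonneg fun i _ => mul_self_nonneg (x i)
  have hle : x ⬝ᵥ F *ᵥ x ≤ t * (x ⬝ᵥ x) := by
    refine le_of_sq_le_sq ?_ (mul_nonneg ht hnn)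
    rw [mul_pow]
    exact hcs.trans (mul_le_mul_of_nonneg_right hsq (sq_nonneg _))
  rw [star_trivial, sub_mulVec, dotProduct_sub, smul_mulVec, one_mulVec, dotProduct_smul,
    smul_eq_mul]
  exact sub_nonneg.mpr hle

/-- Inversion is antitone on positive definite matrices. -/
theorem PosDef.posSemidef_inv_sub_inv {Z W : Matrix m m ℝ} (hZ : Z.PosDef) (hW : W.PosDef)
    (h : (W - Z).PosSemidef) : (Z⁻¹ - W⁻¹).PosSemidef := by
  have hZu := (isUnit_iff_isUnit_det Z).mp hZ.isUnit
  have hWu := (isUnit_iff_isUnit_det W).mp hW.isUnit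
  have key : Z⁻¹ - W⁻¹ = W⁻¹ * (W - Z) * (W⁻¹)ᴴ + (Z⁻¹ - W⁻¹) * Z * (Z⁻¹ - W⁻¹)ᴴ := by
    rw [(hZ.inv.isHermitian.sub hW.inv.isHermitian).eq, hW.inv.isHermitian.eq]
    simp only [Matrix.mul_sub, Matrix.sub_mul, nonsing_inv_mul _ hZu, nonsing_inv_mul _ hWu,
      Matrix.one_mul, Matrix.mul_assoc, mul_nonsing_inv _ hZu, Matrix.mul_one]
    abel
  rw [key]
  exact (h.mul_mul_conjTranspose_same _).add (hZ.posSemidef.mul_mul_conjTranspose_same _)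

end Matrix

/-- A bound on the local norm of `E` at `X` bounds `E` above by a multiple of `X`. -/
theorem posSemidef_smul_sub_of_localNorm_le {n : ℕ} {X E : Matrix (Fin n) (Fin n) ℝ}
    (hX : X.PosDef) (hE : E.IsHermitian) {t : ℝ} (ht : 0 ≤ t) (h : localNorm X E ≤ t) :
    (t • X - E).PosSemidef := by
  have hXu := (Matrix.isUnit_iff_isUnit_det X).mp hX.isUnit
  obtain ⟨R, hR⟩ := hX.inv.posSemidef.exists_eq_conjTranspose_mul_self
  have htr : ((R * E * R.conjTranspose) * (R * E * R.conjTranspose)).trace ≤ t ^ 2 := by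
    refine le_of_eq_of_le ?_ ((Real.sqrt_le_left ht).mp h)
    rw [hR, Matrix.mul_assoc R, Matrix.mul_assoc R, Matrix.trace_mul_comm R]
    rw [Matrix.trace_mul_comm (R.conjTranspose * R * E * (R.conjTranspose * R)) E]
    simp only [Matrix.mul_assoc]
  have hF := Matrix.IsHermitian.posSemidef_smul_one_sub
    (Matrix.isHermitian_mul_mul_conjTranspose R hE) ht htr
  have key : t • X - E = (R * X).conjTranspose * (t • (1 : Matrix (Fin n) (Fin n) ℝ) -
      R * E * R.conjTranspose) * (R * X) := by
    have h₁ : (R * X).conjTranspose * (R * X) = X := by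
      rw [Matrix.conjTranspose_mul, hX.isHermitian.eq, Matrix.mul_assoc,
        ← Matrix.mul_assoc R.conjTranspose, ← hR, Matrix.nonsing_inv_mul _ hXu, Matrix.mul_one]
    have h₂ : (R * X).conjTranspose * R = 1 := by
      rw [Matrix.conjTranspose_mul, hX.isHermitian.eq, Matrix.mul_assoc, ← hR,
        Matrix.mul_nonsing_inv _ hXu]
    have h₃ : R.conjTranspose * (R * X) = 1 := by
      rw [← Matrix.mul_assoc, ← hR, Matrix.nonsing_inv_mul _ hXu]
    rw [Matrix.mul_sub, Matrix.sub_mul, Matrix.mul_smul, Matrix.smul_mul, Matrix.mul_one, h₁,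
      Matrix.mul_assoc R E, ← Matrix.mul_assoc _ R (E * _), h₂, Matrix.one_mul, Matrix.mul_assoc E,
      h₃, Matrix.mul_one]
  rw [key]
  exact hF.conjTranspose_mul_mul_same _

/-- If `Z ≤ c X` in the Loewner order, then the local norm at `X` is at most `c` times the local
norm at `Z`. -/
theorem localNorm_le_mul_of_posSemidef {n : ℕ} {X Z V : Matrix (Fin n) (Fin n) ℝ}
    (hX : X.PosDef) (hZ : Z.PosDef) {c : ℝ} (hc : 0 < c) (h : (c • X - Z).PosSemidef)
    (hV : V.IsHermitian) : localNorm X V ≤ c * localNorm Z V := by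
  have hD := hZ.posSemidef_inv_sub_inv (hX.smul hc) h
  have hinv : (c • X)⁻¹ = c⁻¹ • X⁻¹ :=
    Matrix.inv_smul' X (Units.mk0 c hc.ne') ((Matrix.isUnit_iff_isUnit_det X).mp hX.isUnit)
  rw [hinv] at hD
  have hconj {A : Matrix (Fin n) (Fin n) ℝ} (hA : A.PosDef) : (V * A * V).PosSemidef := by
    simpa only [hV.eq] using hA.posSemidef.mul_mul_conjTranspose_same V
  have h₁ := hD.trace_mul_nonneg_real (hconj hX.inv)
  have h₂ := hD.trace_mul_nonneg_real (hconj hZ.inv)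
  have hswap : (X⁻¹ * (V * Z⁻¹ * V)).trace = (Z⁻¹ * (V * X⁻¹ * V)).trace := by
    rw [Matrix.mul_assoc V, ← Matrix.mul_assoc, Matrix.trace_mul_comm]
    simp only [Matrix.mul_assoc]
  simp only [Matrix.sub_mul, Matrix.smul_mul, Matrix.trace_sub, Matrix.trace_smul,
    smul_eq_mul, sub_nonneg, hswap, inv_mul_le_iff₀ hc] at h₁ h₂
  have hle : (X⁻¹ * V * X⁻¹ * V).trace ≤ c ^ 2 * (Z⁻¹ * V * Z⁻¹ * V).trace := by
    simp only [Matrix.mul_assoc] at h₁ h₂ ⊢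
    rw [sq, mul_assoc]
    exact h₁.trans (mul_le_mul_of_nonneg_left h₂ hc.le)
  calc localNorm X V ≤ Real.sqrt (c ^ 2 * (Z⁻¹ * V * Z⁻¹ * V).trace) := Real.sqrt_le_sqrt hle
    _ = c * localNorm Z V := by
      rw [Real.sqrt_mul (sq_nonneg c), Real.sqrt_sq hc.le, localNorm]


/-- Comparison of local norms near the central path: if `X, Z` are symmetric positive
definite with `‖Z - X‖_X ≤ 1/32`, then every symmetric `Δ` satisfies
`‖Δ‖_X ≤ (31/30) ‖Δ‖_Z`. -/
theorem local_norm_comparison {n : ℕ} (X Z : Matrix (Fin n) (Fin n) ℝ)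
    (hX : X.PosDef) (hZ : Z.PosDef) (hXZ : localNorm X (Z - X) ≤ 1 / 32)
    (Δ : Matrix (Fin n) (Fin n) ℝ) (hΔ : Δ.IsSymm) :
    localNorm X Δ ≤ (31 / 30) * localNorm Z Δ := by
  have hE := posSemidef_smul_sub_of_localNorm_le hX (hZ.isHermitian.sub hX.isHermitian)
    (t := 1 / 32) (by norm_num) hXZ
  have hle : ((33 / 32 : ℝ) • X - Z).PosSemidef := by
    convert hE using 1
    module
  have hV : Δ.IsHermitian := by
    rw [Matrix.IsHermitian, Matrix.conjTranspose_eq_transpose_of_trivial, hΔ.eq]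
  refine (localNorm_le_mul_of_posSemidef hX hZ (by norm_num) hle hV).trans ?_
  exact mul_le_mul_of_nonneg_right (by norm_num) (Real.sqrt_nonneg _)
end

section
/- Let A₁,…,A_m be linearly independent n×n real symmetric matrices and let X be an n×n real symmetric positive definite matrix. Then the m×m matrix M with entries M_{ij} = tr(X·A_i·X·A_j) is symmetric positive definite (in particular nonsingular). -/
open scoped Matrix

open scoped MatrixOrder in
/-- The quadratic form `B ↦ tr(X B X B)` is positive on nonzero symmetric matrices when `X` is
positive definite. -/
lemma Matrix.PosDef.trace_mul_mul_mul_pos {ι : Type*} [Fintype ι] {X B : Matrix ι ι ℝ}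
    (hX : X.PosDef) (hB : B.IsSymm) (hB0 : B ≠ 0) : 0 < (X * B * X * B).trace := by
  classical
  have hXu := hX.isUnit
  obtain ⟨R, rfl⟩ := CStarAlgebra.nonneg_iff_eq_star_mul_self.mp hX.posSemidef.nonneg
  have hR : IsUnit R := by
    rw [Matrix.isUnit_iff_isUnit_det, Matrix.det_mul] at hXu
    exact (Matrix.isUnit_iff_isUnit_det R).2 (isUnit_of_mul_isUnit_right hXu)
  have hBH : Bᴴ = B := by rw [Matrix.conjTranspose_eq_transpose_of_trivial, hB.eq]
  set S := R * B * Rᴴ with hS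
  have hSH : Sᴴ = S := by
    simp only [hS, Matrix.conjTranspose_mul, Matrix.conjTranspose_conjTranspose, hBH,
      Matrix.mul_assoc]
  have htrace : (star R * R * B * (star R * R) * B).trace = (Sᴴ * S).trace := by
    rw [hSH, hS, Matrix.star_eq_conjTranspose, ← Matrix.mul_assoc (R * B * Rᴴ),
      Matrix.trace_mul_comm _ Rᴴ]
    simp only [Matrix.mul_assoc]
  have hS0 : S ≠ 0 := fun h ↦ hB0 <| by
    have hRB : R * B = 0 := hR.star.mul_left_eq_zero.mp h
    exact hR.mul_right_eq_zero.mp hRB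
  rw [htrace]
  exact (Matrix.posSemidef_conjTranspose_mul_self S).trace_nonneg.lt_of_ne'
    (mt Matrix.trace_conjTranspose_mul_self_eq_zero_iff.mp hS0)

/-- The Gram form of the matrices `A i` for `(B, C) ↦ tr(X B X C)`, evaluated at `c`. -/
lemma Matrix.dotProduct_trace_mulVec {ι κ R : Type*} [Fintype ι] [Fintype κ] [CommSemiring R]
    (X : Matrix ι ι R) (A : κ → Matrix ι ι R) (c : κ → R) :
    c ⬝ᵥ (Matrix.of fun i j ↦ (X * A i * X * A j).trace) *ᵥ c =
      (X * (∑ i, c i • A i) * X * ∑ j, c j • A j).trace := by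
  simp only [Matrix.sum_mul, Matrix.trace_sum, dotProduct, Matrix.mulVec,
    Matrix.of_apply, Matrix.mul_smul, Matrix.smul_mul, Matrix.trace_smul, smul_eq_mul,
    Finset.mul_sum]
  rw [Finset.sum_comm]
  refine Finset.sum_congr rfl fun j _ ↦ Finset.sum_congr rfl fun i _ ↦ ?_
  ring

/-- The Schur-complement-free coefficient matrix of the Newton system is positive definite:
if `A₁,…,A_m` are linearly independent symmetric matrices and `X` is symmetric positive
definite, then the `m × m` matrix `M` with `M_{ij} = tr(X Aᵢ X Aⱼ)` is positive definite
(in particular symmetric and nonsingular). -/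
theorem newton_system_matrix_posDef {n m : ℕ}
    (A : Fin m → Matrix (Fin n) (Fin n) ℝ) (hAs : ∀ j, (A j).IsSymm)
    (hA : LinearIndependent ℝ A)
    (X : Matrix (Fin n) (Fin n) ℝ) (hX : X.PosDef) (hXs : X.IsSymm) :
    (Matrix.of fun i j : Fin m => (X * A i * X * A j).trace).PosDef := by
  refine Matrix.PosDef.of_dotProduct_mulVec_pos ?_ fun c hc ↦ ?_
  · ext i j
    simp only [Matrix.conjTranspose_apply, Matrix.of_apply, star_trivial]
    rw [Matrix.mul_assoc (X * A j), Matrix.trace_mul_comm, ← Matrix.mul_assoc]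
  · rw [star_trivial, Matrix.dotProduct_trace_mulVec]
    refine hX.trace_mul_mul_mul_pos ?_ fun h ↦ hc ?_
    · simp only [Matrix.IsSymm, Matrix.transpose_sum, Matrix.transpose_smul, (hAs _).eq]
    · exact funext (Fintype.linearIndependent_iff.mp hA c h)
end
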